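/- arXiv:1712.08984 — 3 statements merged into one kernel-verified Lean document; each statement's English description precedes it below -/
import Mathlib

section
/- Let q be an odd prime power, e an even divisor of q²−1, and χ_e a multiplicative character of F_{q²} with χ_e(ω) = ζ_e := exp(2πi/e) whose restriction to F_q^× equals the quadratic character η of F_q. Let ℓ be an integer not divisible by q+1, and let H be a subset of {0,1,…,e−1} of size e/2 containing exactly one element of each residue class modulo e/2. For s ∈ F_q let N_s := |D_{ℓ,H} ∩ (C_0^{(2,q)} + s)|, let ξ_s = 1 if 1 + ω^ℓ·s ∈ ⋃_{j∈H} C_j^{(e,q²)} and ξ_s = 0 otherwise, and let ξ_ℓ = 1 if ω^ℓ ∈ ⋃_{j∈H} C_j^{(e,q²)} and ξ_ℓ = 0 otherwise. Then, as an identity in ℂ, N_s = (q−1)/4 + (1 − ξ_s − ξ_ℓ)/2 + (G_q(η)/(2q)) · (1 + ∑_{i∈H} ψ'((ω^{ℓq} − ω^ℓ)^{−1}·(1 + ω^{qℓ}·s)·C_i^{(e,q²)}) + ∑_{i∈H} ψ'(−(ω^{ℓq} − ω^ℓ)^{−1}·ω^{qℓ}·C_i^{(e,q²)})). -/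
noncomputable section

open Complex

open scoped Classical

open Classical in
/-- The quadratic character of a finite field, with values in `ℂ`. -/
noncomputable def quadChar (F : Type*) [Field F] : F → ℂ :=
  fun x => if x = 0 then 0 else if IsSquare x then 1 else -1

/-- The `i`-th cyclotomic class `C_i^{(e,q²)} = ω^i ⟨ω^e⟩` of order `e`. -/
def cyc {F2 : Type*} [Field F2] (ω : F2ˣ) (e : ℕ) (i : ℤ) : Set F2 :=
  {x | ∃ k : ℤ, x = ((ω ^ (i + (e : ℤ) * k) : F2ˣ) : F2)}

theorem quadChar_exists (F : Type) [Field F] [Fintype F] (hodd : Odd (Fintype.card F)) :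
    ∃ η : MulChar F ℂ, (∀ x, quadChar F x = η x) ∧ η ≠ 1 ∧ η.IsQuadratic := by
  refine ⟨(quadraticChar F).ringHomComp (Int.castRingHom ℂ), ?_, ?_, ?_⟩
  · intro x
    simp only [quadChar, MulChar.ringHomComp_apply, quadraticChar_apply, quadraticCharFun]
    split_ifs <;> simp
  · have h2 : ringChar F ≠ 2 := by
      intro h
      have := FiniteField.even_card_of_char_two h
      rcases hodd with ⟨k, hk⟩
      omega
    rw [MulChar.ringHomComp_ne_one_iff]
    · exact quadraticChar_ne_one h2
    · exact Int.cast_injective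
  · exact (quadraticChar_isQuadratic F).comp _

/-- twisted Gauss sum -/
theorem gauss_twist {F : Type} [Field F] [Fintype F] (η : MulChar F ℂ) (h1 : η ≠ 1)
    (h2 : η.IsQuadratic) (ψ : AddChar F ℂ) (t : F) :
    ∑ a : F, η a * ψ (a * t) = η t * gaussSum η ψ := by
  by_cases ht : t = 0
  · subst ht
    simp [MulChar.sum_eq_zero_of_ne_one h1, MulChar.map_zero]
  · have := gaussSum_mulShift_eq η ψ (Units.mk0 t ht)
    rw [h2.inv] at this
    simp only [gaussSum, AddChar.mulShift_apply, Units.val_mk0] at this ⊢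
    rw [← this]
    exact Finset.sum_congr rfl fun a _ => by rw [mul_comm a t]

/-- the key Fourier transform computation -/
theorem fourier_core {F F2 : Type} [Field F] [Fintype F] [Field F2] [Fintype F2] [Algebra F F2]
    (η : MulChar F ℂ) (h1 : η ≠ 1) (h2 : η.IsQuadratic) (ψ : AddChar F ℂ)
    (θ : F2)
    (hbij : Function.Bijective (fun p : F × F => algebraMap F F2 p.1 + algebraMap F F2 p.2 * θ))
    (f : F2 → ℂ)
    (hf : ∀ (x : F) (z : F2), f (algebraMap F F2 x * z) = η x * f z)
    (T : F2 → F) (hT : ∀ (x : F) (z : F2), T (algebraMap F F2 x * z) = x * T z) :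
    ∑ y : F2, f y * ψ (T y) = gaussSum η ψ *
      (f θ * η (T θ) + ∑ x : F, f (1 + algebraMap F F2 x * θ) *
        η (T (1 + algebraMap F F2 x * θ))) := by
  have e1 : ∑ y : F2, f y * ψ (T y) = ∑ p : F × F,
      f (algebraMap F F2 p.1 + algebraMap F F2 p.2 * θ) *
        ψ (T (algebraMap F F2 p.1 + algebraMap F F2 p.2 * θ)) :=
    (Fintype.sum_bijective _ hbij _ _ fun p => rfl).symm
  rw [e1, Fintype.sum_prod_type, ← Finset.add_sum_erase _ _ (Finset.mem_univ (0:F)), mul_add]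
  congr 1
  · simp only [map_zero, zero_add, hf, hT]
    have := gauss_twist η h1 h2 ψ (T θ)
    calc _ = f θ * ∑ a : F, η a * ψ (a * T θ) := by
            rw [Finset.mul_sum]; exact Finset.sum_congr rfl fun a _ => by ring
      _ = _ := by rw [this]; ring
  · have e2 : ∀ a ∈ Finset.univ.erase (0:F), ∑ b : F,
        f (algebraMap F F2 a + algebraMap F F2 b * θ) *
        ψ (T (algebraMap F F2 a + algebraMap F F2 b * θ)) =
        ∑ x : F, η a * f (1 + algebraMap F F2 x * θ) *
          ψ (a * T (1 + algebraMap F F2 x * θ)) := by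
      intro a ha
      have ha0 : a ≠ 0 := by simpa using ha
      symm
      refine Fintype.sum_bijective (fun x => a * x) (mulLeft_bijective₀ a ha0) _ _ fun x => ?_
      rw [← hf, ← hT]
      have : algebraMap F F2 a * (1 + algebraMap F F2 x * θ) =
        algebraMap F F2 a + algebraMap F F2 (a * x) * θ := by rw [map_mul]; ring
      rw [this]
    rw [Finset.sum_congr rfl e2]
    have e3 : ∑ a ∈ Finset.univ.erase (0:F), ∑ x : F, η a * f (1 + algebraMap F F2 x * θ) *
          ψ (a * T (1 + algebraMap F F2 x * θ)) = ∑ a : F, ∑ x : F,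
          η a * f (1 + algebraMap F F2 x * θ) * ψ (a * T (1 + algebraMap F F2 x * θ)) := by
      rw [← Finset.add_sum_erase _ _ (Finset.mem_univ (0:F))]
      simp [MulChar.map_zero]
    rw [e3, Finset.sum_comm, Finset.mul_sum]
    refine Finset.sum_congr rfl fun x _ => ?_
    have := gauss_twist η h1 h2 ψ (T (1 + algebraMap F F2 x * θ))
    calc _ = f (1 + algebraMap F F2 x * θ) * ∑ a : F, η a *
            ψ (a * T (1 + algebraMap F F2 x * θ)) := by
            rw [Finset.mul_sum]; exact Finset.sum_congr rfl fun a _ => by ring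
      _ = _ := by rw [this]; ring

theorem H_disj (h : ℕ) (hpos : 0 < h) (H : Finset ℕ)
    (hHres : ∀ r < h, ∃! j, j ∈ H ∧ j % h = r) (n : ℤ) (i j : ℕ) (hi : i ∈ H) (hj : j ∈ H)
    (hin : (h : ℤ) ∣ n - i) (hjn : (h : ℤ) ∣ n - j) : i = j := by
  have h3 : (h:ℤ) ∣ (j:ℤ) - i := by
    have := dvd_sub hin hjn
    rwa [show n - (i:ℤ) - (n - j) = j - i by ring] at this
  have : i % h = j % h := (Nat.modEq_iff_dvd.2 h3)
  exact (hHres (j % h) (Nat.mod_lt _ hpos)).unique ⟨hi, this⟩ ⟨hj, rfl⟩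

/-- shift by `h` complements -/
theorem shift_compl (h : ℕ) (hpos : 0 < h) (H : Finset ℕ)
    (hHres : ∀ r < h, ∃! j, j ∈ H ∧ j % h = r) (n : ℤ) :
    (∃ i ∈ H, ((2 * h : ℕ) : ℤ) ∣ (n + h) - (i : ℤ)) ↔
      ¬ (∃ i ∈ H, ((2 * h : ℕ) : ℤ) ∣ n - (i : ℤ)) := by
  have hz : (0:ℤ) < h := by exact_mod_cast hpos
  constructor
  · rintro ⟨i, hi, a, ha⟩ ⟨j, hj, b, hb⟩
    push_cast at ha hb
    have hij : i = j := H_disj h hpos H hHres n i j hi hj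
      ⟨2 * a - 1, by linear_combination ha⟩ ⟨2 * b, by linear_combination hb⟩
    subst hij
    have h5 : (h:ℤ) * (2 * (a - b) - 1) = 0 := by linear_combination hb - ha
    rcases mul_eq_zero.1 h5 with h6 | h6 <;> omega
  · intro hn
    obtain ⟨r, hr⟩ : ∃ r : ℕ, (r : ℤ) = n % h :=
      ⟨(n % h).toNat, Int.toNat_of_nonneg (Int.emod_nonneg _ hz.ne')⟩
    have hrlt : r < h := by
      have := Int.emod_lt_of_pos n hz
      omega
    obtain ⟨j, ⟨hj, hjr⟩, -⟩ := hHres r hrlt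
    have h3 : (h:ℤ) ∣ n - j := by
      have : ((j % h : ℕ) : ℤ) = n % h := by rw [hjr, hr]
      push_cast at this
      exact Int.ModEq.dvd this
    obtain ⟨k, hk⟩ := h3
    rcases Int.even_or_odd' k with ⟨m, rfl | rfl⟩
    · exact absurd ⟨j, hj, m, by push_cast; linear_combination hk⟩ hn
    · exact ⟨j, hj, m + 1, by push_cast; linear_combination hk⟩


theorem mem_cyc_iff {F2 : Type} [Field F2] (ω : F2ˣ) (e : ℕ) (he : e ∣ orderOf ω)
    (n i : ℤ) : ((ω ^ n : F2ˣ) : F2) ∈ cyc ω e i ↔ (e : ℤ) ∣ n - i := by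
  simp only [cyc, Set.mem_ofPred_eq, Units.val_inj, zpow_eq_zpow_iff_modEq]
  constructor
  · rintro ⟨k, hk⟩
    have h1 : (e:ℤ) ∣ (i + e * k) - n := (Int.natCast_dvd_natCast.2 he).trans hk.dvd
    have h2 := dvd_sub (Dvd.intro k rfl : (e:ℤ) ∣ e * k) h1
    rwa [show (e:ℤ) * k - (i + e * k - n) = n - i by ring] at h2
  · rintro ⟨k, hk⟩
    exact ⟨k, by rw [← hk, add_sub_cancel]⟩

theorem cyc_ne_zero {F2 : Type} [Field F2] (ω : F2ˣ) (e : ℕ) (i : ℤ) :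
    (0 : F2) ∉ cyc ω e i := by
  rintro ⟨k, hk⟩
  exact Units.ne_zero _ hk.symm

/-- signed indicator of the union of classes -/
def sgnU {F2 : Type} [Field F2] (ω : F2ˣ) (e : ℕ) (H : Finset ℕ) (z : F2) : ℂ :=
  if z = 0 then 0 else if ∃ i ∈ H, z ∈ cyc ω e (i : ℤ) then 1 else -1

theorem sgnU_mul {F F2 : Type} [Field F] [Field F2] [Algebra F F2]
    (ω : F2ˣ) (hω : ∀ x : F2ˣ, x ∈ Subgroup.zpowers ω) (h : ℕ) (hpos : 0 < h)
    (he : 2 * h ∣ orderOf ω) (H : Finset ℕ)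
    (hHres : ∀ r < h, ∃! j, j ∈ H ∧ j % h = r)
    (χ : MulChar F2 ℂ)
    (hχω : χ (ω : F2) = Complex.exp (2 * Real.pi * Complex.I / (2 * h : ℕ)))
    (η : MulChar F ℂ) (hη : η.IsQuadratic)
    (hχη : ∀ x : F, x ≠ 0 → χ (algebraMap F F2 x) = η x) (x : F) (z : F2) :
    sgnU ω (2 * h) H (algebraMap F F2 x * z) = η x * sgnU ω (2 * h) H z := by
  by_cases hx : x = 0
  · subst hx; simp [sgnU, MulChar.map_zero]
  by_cases hz : z = 0
  · subst hz; simp [sgnU]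
  have hx' : algebraMap F F2 x ≠ 0 := by simpa using hx
  obtain ⟨m, hm⟩ := hω (Units.mk0 _ hx')
  obtain ⟨n, hn⟩ := hω (Units.mk0 _ hz)
  simp only at hm hn
  have hm' : algebraMap F F2 x = ((ω ^ m : F2ˣ) : F2) := by rw [hm]; rfl
  have hn' : z = ((ω ^ n : F2ˣ) : F2) := by rw [hn]; rfl
  have hprim := Complex.isPrimitiveRoot_exp (2 * h) (by omega)
  have hval : η x = Complex.exp (2 * Real.pi * Complex.I / (2 * h : ℕ)) ^ m := by
    rw [← hχη x hx, hm', ← hχω, ← MulChar.coe_toUnitHom, map_zpow, Units.val_zpow_eq_zpow_val,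
      MulChar.coe_toUnitHom]
  have hprod : algebraMap F F2 x * z = ((ω ^ (n + m) : F2ˣ) : F2) := by
    rw [hm', hn', zpow_add, Units.val_mul, mul_comm]
  have key : ∀ k : ℤ, sgnU ω (2 * h) H ((ω ^ k : F2ˣ) : F2) =
      if ∃ i ∈ H, ((2 * h : ℕ) : ℤ) ∣ k - (i : ℤ) then 1 else -1 := by
    intro k
    simp only [sgnU, Units.ne_zero, if_false, mem_cyc_iff ω (2 * h) he]
  have per : ∀ k t : ℤ, ((∃ i ∈ H, ((2 * h : ℕ) : ℤ) ∣ (k + (2 * h : ℕ) * t) - (i : ℤ)) ↔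
      ∃ i ∈ H, ((2 * h : ℕ) : ℤ) ∣ k - (i : ℤ)) := by
    intro k t
    refine exists_congr fun i => and_congr_right fun _ => ?_
    rw [show k + ((2 * h : ℕ) : ℤ) * t - i = (k - i) + ((2 * h : ℕ) : ℤ) * t by ring]
    exact dvd_add_left (Dvd.intro t rfl)
  rw [hprod, hn', key, key]
  have hhalf : Complex.exp (2 * Real.pi * Complex.I / (2 * h : ℕ)) ^ (h : ℤ) = -1 := by
    rw [zpow_natCast, ← Complex.exp_nat_mul, ← Complex.exp_pi_mul_I]
    congr 1
    have : (h : ℂ) ≠ 0 := by exact_mod_cast hpos.ne'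
    push_cast
    field_simp
  rcases hη x with h0 | h0 | h0
  · exfalso
    rw [h0] at hval
    exact zpow_ne_zero _ (Complex.exp_ne_zero _) hval.symm
  · rw [h0] at hval ⊢
    obtain ⟨t, rfl⟩ := (hprim.zpow_eq_one_iff_dvd m).1 hval.symm
    rw [one_mul]
    simp only [per]
  · rw [h0] at hval ⊢
    have : Complex.exp (2 * Real.pi * Complex.I / (2 * h : ℕ)) ^ (m - h) = 1 := by
      rw [zpow_sub₀ (Complex.exp_ne_zero _), ← hval, hhalf]; norm_num
    obtain ⟨t, ht⟩ := (hprim.zpow_eq_one_iff_dvd _).1 this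
    obtain rfl : m = h + (2 * h : ℕ) * t := by linear_combination ht
    rw [← add_assoc]
    simp only [per, shift_compl h hpos H hHres]
    split_ifs <;> simp

theorem sum_cyc {F2 : Type} [Field F2] [Fintype F2]
    (ω : F2ˣ) (hω : ∀ x : F2ˣ, x ∈ Subgroup.zpowers ω) (h : ℕ) (hpos : 0 < h)
    (he : 2 * h ∣ orderOf ω) (H : Finset ℕ)
    (hHres : ∀ r < h, ∃! j, j ∈ H ∧ j % h = r) (g : F2 → ℂ) (g0 : g 0 = 1)
    (hg : ∑ y, g y = 0) :
    2 * ∑ i ∈ H, ∑ᶠ y ∈ cyc ω (2 * h) (i : ℤ), g y = -1 + ∑ y, sgnU ω (2 * h) H y * g y := by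
  have e1 : ∀ i : ℕ, ∑ᶠ y ∈ cyc ω (2 * h) (i : ℤ), g y =
      ∑ y, if y ∈ cyc ω (2 * h) (i : ℤ) then g y else 0 := by
    intro i
    rw [finsum_mem_def, finsum_eq_sum_of_fintype]
    exact Finset.sum_congr rfl fun y _ => by rw [Set.indicator_apply]
  simp only [e1]
  rw [Finset.sum_comm]
  have e2 : ∀ y : F2, (∑ i ∈ H, if y ∈ cyc ω (2 * h) (i : ℤ) then g y else 0) =
      if ∃ i ∈ H, y ∈ cyc ω (2 * h) (i : ℤ) then g y else 0 := by
    intro y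
    split_ifs with hy
    · obtain ⟨i, hi, hyi⟩ := hy
      rw [Finset.sum_eq_single_of_mem i hi, if_pos hyi]
      intro j hj hji
      rw [if_neg]
      intro hyj
      apply hji
      have hy0 : y ≠ 0 := fun h0 => cyc_ne_zero ω _ _ (h0 ▸ hyi)
      obtain ⟨n, hn⟩ := hω (Units.mk0 y hy0)
      simp only at hn
      obtain rfl : y = ((ω ^ n : F2ˣ) : F2) := by rw [hn]; rfl
      rw [mem_cyc_iff ω _ he] at hyi hyj
      have hd : (h:ℤ) ∣ ((2 * h : ℕ) : ℤ) := ⟨2, by push_cast; ring⟩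
      exact H_disj h hpos H hHres n j i hj hi (hd.trans hyj) (hd.trans hyi)
    · refine Finset.sum_eq_zero fun i hi => if_neg fun hyi => hy ⟨i, hi, hyi⟩
  simp only [e2]
  have e3 : ∀ y : F2, 2 * (if ∃ i ∈ H, y ∈ cyc ω (2 * h) (i : ℤ) then g y else 0) =
      g y + sgnU ω (2 * h) H y * g y - (if y = 0 then 1 else 0) := by
    intro y
    by_cases hy : y = 0
    · subst hy
      simp [sgnU, cyc_ne_zero, g0]
    · simp only [sgnU, hy, if_false]
      split_ifs <;> ring
  rw [Finset.mul_sum, Finset.sum_congr rfl fun y _ => e3 y, Finset.sum_sub_distrib,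
    Finset.sum_add_distrib, hg]
  simp
  ring

/-- the size of `D_{ℓ,H} ∩ (C_0^{(2,q)} + s)` expressed via character sums
over cyclotomic classes (Proposition 3.6 of the paper). -/
theorem stmt_8 (q e : ℕ) (hq : IsPrimePow q) (hqodd : Odd q)
    (he : e ∣ q ^ 2 - 1) (heven : Even e)
    (F F2 : Type) [Field F] [Fintype F] [Field F2] [Fintype F2] [Algebra F F2]
    (hF : Fintype.card F = q) (hF2 : Fintype.card F2 = q ^ 2)
    (ω : F2ˣ) (hω : ∀ x : F2ˣ, x ∈ Subgroup.zpowers ω)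
    (ψ : AddChar F ℂ) (hψ : ∃ a, ψ a ≠ 1)
    (tr : F2 → F) (htr : ∀ x : F2, algebraMap F F2 (tr x) = x + x ^ q)
    (χ : MulChar F2 ℂ)
    (hχω : χ (ω : F2) = Complex.exp (2 * Real.pi * Complex.I / e))
    (hχη : ∀ x : F, x ≠ 0 → χ (algebraMap F F2 x) = quadChar F x)
    (ℓ : ℤ) (hℓ : ¬ ((q : ℤ) + 1 ∣ ℓ))
    (H : Finset ℕ) (hHsub : H ⊆ Finset.range e) (hHcard : H.card = e / 2)
    (hHres : ∀ r < e / 2, ∃! j, j ∈ H ∧ j % (e / 2) = r)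
    (C₀ : Set F) (hC₀ : C₀ = {x : F | x ≠ 0 ∧ IsSquare x})
    (D : Set F)
    (hD : D = {x : F | ∃ i ∈ H, (1 + algebraMap F F2 x * ((ω ^ ℓ : F2ˣ) : F2)) ∈ cyc ω e (i : ℤ)})
    (N : F → ℕ) (hN : ∀ s : F, N s = (D ∩ ((fun x => x + s) '' C₀)).ncard)
    (ξ : F → ℂ)
    (hξ : ∀ s : F, ξ s =
      if (1 + ((ω ^ ℓ : F2ˣ) : F2) * algebraMap F F2 s) ∈ ⋃ j ∈ H, cyc ω e (j : ℤ) then 1 else 0)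
    (ξℓ : ℂ)
    (hξℓ : ξℓ = if ((ω ^ ℓ : F2ˣ) : F2) ∈ ⋃ j ∈ H, cyc ω e (j : ℤ) then 1 else 0) :
    ∀ s : F,
      (N s : ℂ) =
        ((q : ℂ) - 1) / 4 + (1 - ξ s - ξℓ) / 2 +
          ((∑ x : F, quadChar F x * ψ x) / (2 * q)) *
            (1 +
              (∑ i ∈ H, ∑ᶠ y ∈ cyc ω e (i : ℤ),
                ψ (tr ((((ω ^ (ℓ * (q : ℤ)) : F2ˣ) : F2) - ((ω ^ ℓ : F2ˣ) : F2))⁻¹ *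
                  (1 + ((ω ^ ((q : ℤ) * ℓ) : F2ˣ) : F2) * algebraMap F F2 s) * y))) +
              (∑ i ∈ H, ∑ᶠ y ∈ cyc ω e (i : ℤ),
                ψ (tr (-((((ω ^ (ℓ * (q : ℤ)) : F2ˣ) : F2) - ((ω ^ ℓ : F2ˣ) : F2))⁻¹ *
                  ((ω ^ ((q : ℤ) * ℓ) : F2ˣ) : F2)) * y)))) := by
  obtain ⟨h, rfl⟩ : ∃ h, e = 2 * h := by
    obtain ⟨h, hh⟩ := heven
    exact ⟨h, by omega⟩
  subst hF
  have hq1 : 1 < Fintype.card F := hq.one_lt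
  have hpos : 0 < h := by
    rcases Nat.eq_zero_or_pos h with rfl | h'
    · simp only [mul_zero, zero_dvd_iff] at he
      have : 1 < Fintype.card F ^ 2 := Nat.one_lt_pow (by norm_num) hq1
      omega
    · exact h'
  rw [Nat.mul_div_cancel_left h two_pos] at hHres
  have hord : orderOf ω = Fintype.card F ^ 2 - 1 := by
    rw [orderOf_eq_card_of_forall_mem_zpowers hω, Nat.card_eq_fintype_card, Fintype.card_units, hF2]
  rw [← hord] at he
  obtain ⟨η, hqη, hη1, hη2⟩ := quadChar_exists F hqodd
  have hχη' : ∀ x : F, x ≠ 0 → χ (algebraMap F F2 x) = η x := fun x hx => by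
    rw [hχη x hx, hqη]
  have hfmul := sgnU_mul ω hω h hpos he H hHres χ hχω η hη2 hχη'
  set f := sgnU ω (2 * h) H with hfdef
  set θ : F2 := ((ω ^ ℓ : F2ˣ) : F2) with hθ
  have hθq1 : ((ω ^ (ℓ * (Fintype.card F : ℤ)) : F2ˣ) : F2) = θ ^ Fintype.card F := by
    rw [zpow_mul, zpow_natCast, Units.val_pow_eq_pow_val]
  have hθq2 : ((ω ^ ((Fintype.card F : ℤ) * ℓ) : F2ˣ) : F2) = θ ^ Fintype.card F := by
    rw [mul_comm, hθq1]
  rw [hθq1, hθq2]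
  set σ := FiniteField.frobeniusAlgHom F F2 with hσ
  have hσa : ∀ x, x ^ Fintype.card F = σ x := fun x => rfl
  have hσσ : ∀ x, σ (σ x) = x := fun x => by
    rw [← hσa, ← hσa, ← pow_mul, ← sq, ← hF2, FiniteField.pow_card]
  simp only [hσa] at htr ⊢
  have hinj : Function.Injective (algebraMap F F2) := (algebraMap F F2).injective
  have tr_add : ∀ x y, tr (x + y) = tr x + tr y := fun x y => hinj (by
    rw [map_add, htr, htr, htr, map_add]; ring)
  have tr_smul : ∀ (a : F) y, tr (algebraMap F F2 a * y) = a * tr y := fun a y => hinj (by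
    rw [map_mul, htr, htr, map_mul, AlgHom.commutes]; ring)
  have tr_zero : tr 0 = 0 := by simpa using tr_smul 0 0
  have hθne : σ θ ≠ θ := by
    intro hc
    rw [← hσa, ← hθq1, hθ, Units.val_inj, zpow_eq_zpow_iff_modEq, hord] at hc
    have h1 := hc.symm.dvd
    have h2 : ((Fintype.card F ^ 2 - 1 : ℕ) : ℤ) =
        ((Fintype.card F : ℤ) - 1) * ((Fintype.card F : ℤ) + 1) := by
      rw [Nat.cast_sub (Nat.one_le_pow _ _ (by omega))]; push_cast; ring
    rw [h2, show ℓ * (Fintype.card F : ℤ) - ℓ = ((Fintype.card F : ℤ) - 1) * ℓ by ring] at h1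
    exact hℓ (Int.dvd_of_mul_dvd_mul_left (by omega) h1)
  have hθF : ∀ a : F, algebraMap F F2 a ≠ θ := by
    intro a ha
    apply hθne
    rw [← ha]
    exact AlgHom.commutes σ a
  set δ := σ θ - θ with hδ
  have hδ0 : δ ≠ 0 := sub_ne_zero.2 hθne
  have hσδ : σ δ = -δ := by rw [hδ, map_sub, hσσ]; ring
  have hindep : ∀ a b : F, algebraMap F F2 a + algebraMap F F2 b * θ = 0 → a = 0 ∧ b = 0 := by
    intro a b hab
    have hb : b = 0 := by
      by_contra hb
      have hb' : algebraMap F F2 b ≠ 0 := by simpa using hb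
      apply hθF (-a / b)
      rw [map_div₀, map_neg, div_eq_iff hb']
      linear_combination -hab
    subst hb
    simpa using hab
  have hbij : Function.Bijective
      (fun p : F × F => algebraMap F F2 p.1 + algebraMap F F2 p.2 * θ) := by
    rw [Fintype.bijective_iff_injective_and_card]
    constructor
    · rintro ⟨a, b⟩ ⟨c, d⟩ hh
      simp only at hh
      have := hindep (a - c) (b - d) (by rw [map_sub, map_sub]; linear_combination hh)
      rw [Prod.mk.injEq]
      exact ⟨sub_eq_zero.1 this.1, sub_eq_zero.1 this.2⟩
    · rw [Fintype.card_prod, hF2, sq]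
  have h1x : ∀ x : F, 1 + algebraMap F F2 x * θ ≠ 0 := fun x hx => by
    have := hindep 1 x (by rw [map_one]; exact hx)
    exact one_ne_zero this.1
  have hθ0 : θ ≠ 0 := Units.ne_zero _
  have hψ1 : ψ ≠ 1 := by
    obtain ⟨a, ha⟩ := hψ
    rintro rfl
    exact ha (by simp)
  have hG : gaussSum η ψ ^ 2 = η (-1) * Fintype.card F :=
    gaussSum_sq hη1 hη2 (AddChar.IsPrimitive.of_ne_one hψ1)
  have hm1 : η (-1) * η (-1) = 1 := by rw [← map_mul]; simp
  have hq0 : (Fintype.card F : ℂ) ≠ 0 := by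
    have : Fintype.card F ≠ 0 := by omega
    exact_mod_cast this
  -- the sum over classes
  have hS : ∀ c p : F2, tr (c * p) = -1 →
      2 * ∑ i ∈ H, ∑ᶠ y ∈ cyc ω (2 * h) (i : ℤ), ψ (tr (c * y)) =
        -1 + gaussSum η ψ * (f θ * η (tr (c * θ)) + ∑ x : F, f (1 + algebraMap F F2 x * θ) *
          η (tr (c * (1 + algebraMap F F2 x * θ)))) := by
    intro c p hp
    have hlin : ∀ (x : F) (z : F2), tr (c * (algebraMap F F2 x * z)) = x * tr (c * z) := by
      intro x z
      rw [← tr_smul]; congr 1; ring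
    have hsum : ∑ y, ψ (tr (c * y)) = 0 := by
      let ψ' : AddChar F2 ℂ :=
        { toFun := fun y => ψ (tr (c * y))
          map_zero_eq_one' := by simp [tr_zero]
          map_add_eq_mul' := fun a b => by rw [mul_add, tr_add, AddChar.map_add_eq_mul] }
      have : ψ' ≠ 1 := by
        obtain ⟨a, ha⟩ := hψ
        intro hc
        apply ha
        have h2 : ψ (tr (c * (algebraMap F F2 (-a) * p))) = 1 := by
          have := DFunLike.congr_fun hc (algebraMap F F2 (-a) * p)
          rw [AddChar.one_apply] at this
          exact this
        rwa [hlin, hp, neg_mul_neg, mul_one] at h2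
      exact AddChar.sum_eq_zero_of_ne_one this
    rw [sum_cyc ω hω h hpos he H hHres (fun y => ψ (tr (c * y))) (by simp [tr_zero]) hsum,
      ← fourier_core η hη1 hη2 ψ θ hbij f hfmul (fun y => tr (c * y)) hlin]
  intro s
  have hc1 : ∀ x : F, tr (δ⁻¹ * (1 + σ θ * algebraMap F F2 s) * (1 + algebraMap F F2 x * θ))
      = s - x := fun x => hinj (by
    rw [htr]
    simp only [map_mul, map_add, map_sub, map_one, map_inv₀, hσδ, hσσ, AlgHom.commutes]
    field_simp
    rw [hδ]; ring)
  have hc1θ : tr (δ⁻¹ * (1 + σ θ * algebraMap F F2 s) * θ) = -1 := hinj (by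
    rw [htr]
    simp only [map_mul, map_add, map_neg, map_one, map_inv₀, hσδ, hσσ, AlgHom.commutes]
    field_simp
    rw [hδ]; ring)
  have hc2 : ∀ x : F, tr (-(δ⁻¹ * σ θ) * (1 + algebraMap F F2 x * θ)) = -1 := fun x => hinj (by
    rw [htr]
    simp only [map_mul, map_add, map_neg, map_one, map_inv₀, hσδ, hσσ, AlgHom.commutes]
    field_simp
    rw [hδ]; ring)
  have hc2θ : tr (-(δ⁻¹ * σ θ) * θ) = 0 := hinj (by
    rw [htr]
    simp only [map_mul, map_neg, map_zero, map_inv₀, hσδ, hσσ]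
    field_simp
    ring)
  have hS1 := hS _ _ hc1θ
  have hS2 := hS _ _ (hc2 0)
  simp only [hc1, hc1θ, hc2, hc2θ, MulChar.map_zero] at hS1 hS2
  have hgs : ∑ x : F, quadChar F x * ψ x = gaussSum η ψ := by
    simp only [hqη, gaussSum]
  rw [hgs]
  have hfv : ∀ z : F2, z ≠ 0 → (f z = 2 * (if ∃ i ∈ H, z ∈ cyc ω (2 * h) (i : ℤ) then 1 else 0) - 1) := by
    intro z hz
    rw [hfdef]
    simp only [sgnU, hz, if_false]
    split_ifs <;> norm_num
  have hξs : f (1 + algebraMap F F2 s * θ) = 2 * ξ s - 1 := by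
    rw [hfv _ (h1x s), hξ s]
    simp only [Set.mem_iUnion, exists_prop, mul_comm θ]
  have hξl : f θ = 2 * ξℓ - 1 := by
    rw [hfv _ hθ0, hξℓ]
    simp only [Set.mem_iUnion, exists_prop]
  -- the count
  have hcount : (N s : ℂ) = ∑ x : F, (if x = s then 0 else
      (1 + η (x - s)) / 2 * ((1 + f (1 + algebraMap F F2 x * θ)) / 2)) := by
    have hset : D ∩ ((fun x => x + s) '' C₀) = ↑(Finset.univ.filter fun x : F =>
        (∃ i ∈ H, 1 + algebraMap F F2 x * θ ∈ cyc ω (2 * h) (i : ℤ)) ∧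
          (x - s ≠ 0 ∧ IsSquare (x - s))) := by
      ext x
      rw [hD, hC₀]
      simp only [Set.mem_inter_iff, Set.mem_ofPred_eq, Set.mem_image, Finset.coe_filter,
        Finset.mem_univ, true_and]
      refine and_congr_right fun _ => ?_
      constructor
      · rintro ⟨y, hy, rfl⟩
        rwa [add_sub_cancel_right]
      · intro hy
        exact ⟨x - s, hy, sub_add_cancel x s⟩
    rw [hN s, hset, Set.ncard_coe_finset, Finset.natCast_card_filter]
    refine Finset.sum_congr rfl fun x _ => ?_
    rw [hfv _ (h1x x), ← hqη]
    by_cases hx : x = s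
    · subst hx; simp
    · have hx' : x - s ≠ 0 := sub_ne_zero.2 hx
      simp only [quadChar, hx, hx', if_false]
      by_cases ha : (∃ i ∈ H, 1 + algebraMap F F2 x * θ ∈ cyc ω (2 * h) (i : ℤ)) <;>
      by_cases hb : IsSquare (x - s) <;> simp only [ha, hb] <;> norm_num [hx']
  have hcount2 : 4 * (N s : ℂ) = (Fintype.card F - 1) +
      (∑ x : F, f (1 + algebraMap F F2 x * θ)) - f (1 + algebraMap F F2 s * θ) +
      ∑ x : F, f (1 + algebraMap F F2 x * θ) * η (x - s) := by
    have e1 : ∀ x : F, 4 * (if x = s then 0 else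
      (1 + η (x - s)) / 2 * ((1 + f (1 + algebraMap F F2 x * θ)) / 2)) =
        1 + η (x - s) + f (1 + algebraMap F F2 x * θ) +
          f (1 + algebraMap F F2 x * θ) * η (x - s) -
          (if x = s then 1 + f (1 + algebraMap F F2 s * θ) else 0) := by
      intro x
      split_ifs with hx
      · subst hx
        simp [MulChar.map_zero]
      · ring
    have e2 : ∑ x : F, η (x - s) = 0 := by
      rw [← MulChar.sum_eq_zero_of_ne_one hη1]
      exact Fintype.sum_bijective (fun x => x - s) (Equiv.subRight s).bijective _ _ fun x => rfl
    rw [hcount, Finset.mul_sum, Finset.sum_congr rfl fun x _ => e1 x, Finset.sum_sub_distrib,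
      Finset.sum_add_distrib, Finset.sum_add_distrib, Finset.sum_add_distrib, e2]
    simp
    ring
  have hneg : ∑ x : F, f (1 + algebraMap F F2 x * θ) * η (s - x) =
      η (-1) * ∑ x : F, f (1 + algebraMap F F2 x * θ) * η (x - s) := by
    rw [Finset.mul_sum]
    refine Finset.sum_congr rfl fun x _ => ?_
    rw [show s - x = (-1) * (x - s) by ring, map_mul]
    ring
  rw [hneg] at hS1
  rw [← Finset.sum_mul] at hS2
  rw [hξs] at hcount2
  rw [hξl] at hS1
  generalize (∑ i ∈ H, ∑ᶠ y ∈ cyc ω (2 * h) (i : ℤ),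
    ψ (tr (δ⁻¹ * (1 + σ θ * algebraMap F F2 s) * y))) = S1 at *
  generalize (∑ i ∈ H, ∑ᶠ y ∈ cyc ω (2 * h) (i : ℤ),
    ψ (tr (-(δ⁻¹ * σ θ) * y))) = S2 at *
  generalize ∑ x : F, f (1 + algebraMap F F2 x * θ) * η (x - s) = B at *
  generalize ∑ x : F, f (1 + algebraMap F F2 x * θ) = A at *
  generalize gaussSum η ψ = G at *
  generalize (Fintype.card F : ℂ) = Q at *
  generalize (N s : ℂ) = n at *
  generalize η (-1) = ε at *
  have hfin : G * (1 + S1 + S2) * 2 = Q * (2 * ξℓ - 1 + B + A) := by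
    linear_combination G * hS1 + G * hS2 + ε * (2 * ξℓ - 1 + B + A) * hG + Q * (2 * ξℓ - 1 + B + A) * hm1
  have : G / (2 * Q) * (1 + S1 + S2) = (2 * ξℓ - 1 + B + A) / 4 := by
    rw [div_mul_eq_mul_div, div_eq_div_iff (mul_ne_zero two_ne_zero hq0) (by norm_num)]
    linear_combination 2 * hfin
  rw [this]
  linear_combination hcount2 / 4
end
end

section
/- Let m be a positive integer such that q = 4m² + 4m + 3 is a prime power. Let χ₈ be a multiplicative character of F_{q²} with χ₈(ω) = ζ₈ := exp(2πi/8), and suppose ε, δ ∈ {1, −1} satisfy G_{q²}(χ₈) = G_q(η)·(ε(2m+1) + δ·i·√2) in ℂ. Let h' ∈ {0,1,2,3}, put h := 2h' + (1 − εδ)/2, and let ℓ be an integer with χ₈(ω^ℓ) = ζ₈^{2 − 5εδ − 6h'} and χ₈(ω^{ℓq} − ω^ℓ) = −i^δ. Set H := {h, h+1, h+2, h+3} with elements reduced modulo 8, and D := {x ∈ F_q : 1 + x·ω^ℓ ∈ ⋃_{i∈H} C_i^{(8,q²)}}. Then |D| = 2m² + m + 2 and { |D ∩ ((C_0^{(2,q)}∪{0})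 + s)| : s ∈ F_q } = {m²+1, m²+2, m²+m+1, m²+m+2}. -/
noncomputable section

open Complex

open scoped Classical

theorem z_val : Complex.exp (2 * Real.pi * Complex.I / 8) =
    ((Real.sqrt 2 / 2 : ℝ) : ℂ) + ((Real.sqrt 2 / 2 : ℝ) : ℂ) * Complex.I := by
  have : (2 * Real.pi * Complex.I / 8 : ℂ) = ((Real.pi / 4 : ℝ) : ℂ) * Complex.I := by
    push_cast; ring
  rw [this, Complex.exp_mul_I, ← Complex.ofReal_cos, ← Complex.ofReal_sin,
    Real.cos_pi_div_four, Real.sin_pi_div_four]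

theorem sqrt2_sq : ((Real.sqrt 2 : ℝ) : ℂ) ^ 2 = 2 := by
  rw [← Complex.ofReal_pow, Real.sq_sqrt (by norm_num)]; norm_num

theorem z_sq {z : ℂ} (hz : z = Complex.exp (2 * Real.pi * Complex.I / 8)) :
    z ^ 2 = Complex.I := by
  rw [hz, z_val]
  push_cast
  have := sqrt2_sq
  have hI := Complex.I_sq
  linear_combination (1/4 + Complex.I/2 + Complex.I^2/4) * this + (1/2)* hI

theorem z_four {z : ℂ} (hz : z = Complex.exp (2 * Real.pi * Complex.I / 8)) :
    z ^ 4 = -1 := by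
  have h := z_sq hz
  have hI := Complex.I_sq
  linear_combination (z^2 + Complex.I) * h + hI

theorem z_sqrt {z : ℂ} (hz : z = Complex.exp (2 * Real.pi * Complex.I / 8)) :
    z + z ^ 3 = Complex.I * Real.sqrt 2 := by
  have h := z_sq hz
  have h1 : z = _ := hz.trans z_val
  push_cast at h1
  have hI := Complex.I_sq
  linear_combination z * h + (1+Complex.I) * h1 + (Real.sqrt 2/2) * hI

theorem irr_aux (a b : ℤ) (h : (a : ℝ) + b * (Real.sqrt 2 / 2) = 0) : a = 0 ∧ b = 0 := by
  have hs : Real.sqrt 2 ^ 2 = 2 := Real.sq_sqrt (by norm_num)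
  have hb : b = 0 := by
    by_contra hb
    have hb' : (b : ℝ) ≠ 0 := by exact_mod_cast hb
    have : Real.sqrt 2 = ((-2 * a / b : ℚ) : ℝ) := by
      push_cast
      field_simp
      linarith
    exact irrational_sqrt_two ⟨_, this.symm⟩
  subst hb
  simp at h
  exact ⟨h, rfl⟩

theorem z_indep {z : ℂ} (hz : z = Complex.exp (2 * Real.pi * Complex.I / 8)) (a b c d : ℤ)
    (h : (a : ℂ) + b * z + c * z ^ 2 + d * z ^ 3 = 0) : a = 0 ∧ b = 0 ∧ c = 0 ∧ d = 0 := by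
  have h2 := z_sq hz
  have h1 : z = _ := hz.trans z_val
  have h3 : z ^ 3 = z * Complex.I := by rw [← h2]; ring
  rw [h3, h2, h1] at h
  have hre := congrArg Complex.re h
  have him := congrArg Complex.im h
  simp at hre him
  have e1 := irr_aux a (b - d) (by push_cast; linarith)
  have e2 := irr_aux c (b + d) (by push_cast; linarith)
  omega

/-- coordinates -/
def rr (k j : ℕ) : ℤ := if j = k then 1 else if j = k + 4 then -1 else 0

theorem z_coord {z : ℂ} (h4 : z ^ 4 = -1) (j : ℕ) (hj : j < 8) :
    z ^ j = (rr 0 j : ℂ) + rr 1 j * z + rr 2 j * z ^ 2 + rr 3 j * z ^ 3 := by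
  interval_cases j <;> simp [rr]
  · exact h4
  · linear_combination z * h4
  · linear_combination z ^ 2 * h4
  · linear_combination z ^ 3 * h4

theorem coord_sum {F : Type} [Fintype F] {z : ℂ}
    (hz : z = Complex.exp (2 * Real.pi * Complex.I / 8)) (J : F → ℕ) (hJ : ∀ x, J x < 8)
    (w : F → ℤ) (a b c d : ℤ)
    (h : ∑ x, z ^ J x * (w x : ℂ) = a + b * z + c * z ^ 2 + d * z ^ 3) :
    ∑ x, rr 0 (J x) * w x = a ∧ ∑ x, rr 1 (J x) * w x = b ∧ ∑ x, rr 2 (J x) * w x = c ∧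
      ∑ x, rr 3 (J x) * w x = d := by
  have h4 := z_four hz
  have key : ((∑ x, rr 0 (J x) * w x - a : ℤ) : ℂ) + ((∑ x, rr 1 (J x) * w x - b : ℤ) : ℂ) * z
     + ((∑ x, rr 2 (J x) * w x - c : ℤ) : ℂ) * z ^ 2
     + ((∑ x, rr 3 (J x) * w x - d : ℤ) : ℂ) * z ^ 3 = 0 := by
    have : ∑ x, z ^ J x * (w x : ℂ) = ∑ x, (((rr 0 (J x) : ℂ) * w x)
        + (rr 1 (J x) * w x) * z + (rr 2 (J x) * w x) * z ^ 2 + (rr 3 (J x) * w x) * z ^ 3) := by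
      refine Finset.sum_congr rfl fun x _ => ?_
      rw [z_coord h4 _ (hJ x)]; ring
    rw [this, Finset.sum_add_distrib, Finset.sum_add_distrib, Finset.sum_add_distrib,
      ← Finset.sum_mul, ← Finset.sum_mul, ← Finset.sum_mul] at h
    push_cast
    linear_combination h
  obtain ⟨h0, h1, h2, h3⟩ := z_indep hz _ _ _ _ key
  omega

/-- sign -/
def gg (j : ℕ) : ℤ := if j < 4 then 1 else -1

theorem gg_eq (j : ℕ) (hj : j < 8) : gg j = rr 0 j + rr 1 j + rr 2 j + rr 3 j := by
  interval_cases j <;> simp [rr, gg]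

theorem g_sum {F : Type} [Fintype F] {z : ℂ}
    (hz : z = Complex.exp (2 * Real.pi * Complex.I / 8)) (J : F → ℕ) (hJ : ∀ x, J x < 8)
    (w : F → ℤ) (a b c d : ℤ)
    (h : ∑ x, z ^ J x * (w x : ℂ) = a + b * z + c * z ^ 2 + d * z ^ 3) :
    ∑ x, gg (J x) * w x = a + b + c + d := by
  obtain ⟨h0, h1, h2, h3⟩ := coord_sum hz J hJ w a b c d h
  rw [← h0, ← h1, ← h2, ← h3, ← Finset.sum_add_distrib, ← Finset.sum_add_distrib,
    ← Finset.sum_add_distrib]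
  refine Finset.sum_congr rfl fun x _ => ?_
  rw [gg_eq _ (hJ x)]; ring

theorem exists_of_pos {F : Type} [Fintype F] (J : F → ℕ) (k : ℕ)
    (h : ∑ x, rr k (J x) * 1 = 1) : ∃ x, J x = k := by
  by_contra hc
  push Not at hc
  have : ∑ x, rr k (J x) * 1 ≤ 0 := by
    refine Finset.sum_nonpos fun x _ => ?_
    simp only [rr, hc x, if_false]
    split_ifs <;> simp
  omega

theorem exists_both {F : Type} [Fintype F] (J : F → ℕ) (k : ℕ)
    (h : ∑ x, rr k (J x) * 1 = 0) (he : ∃ x, J x = k ∨ J x = k + 4) :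
    (∃ x, J x = k) ∧ ∃ x, J x = k + 4 := by
  obtain ⟨x0, hx0⟩ := he
  constructor
  · by_contra hc
    push Not at hc
    have : ∑ x, rr k (J x) * 1 < ∑ x : F, 0 := by
      refine Finset.sum_lt_sum (fun x _ => ?_) ⟨x0, Finset.mem_univ _, ?_⟩
      · simp only [rr, hc x, if_false]
        split_ifs <;> simp
      · rcases hx0 with h0 | h0
        · exact absurd h0 (hc _)
        · simp [rr, h0]
    simp at this h
    omega
  · by_contra hc
    push Not at hc
    have : ∑ x : F, 0 < ∑ x, rr k (J x) * 1 := by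
      refine Finset.sum_lt_sum (fun x _ => ?_) ⟨x0, Finset.mem_univ _, ?_⟩
      · simp only [rr, hc x, if_false]
        split_ifs <;> simp
      · rcases hx0 with h0 | h0
        · simp [rr, h0]
        · exact absurd h0 (hc _)
    simp at this h
    omega

theorem count_D {F : Type} [Fintype F] (J : F → ℕ) :
    2 * (({x | J x < 4} : Set F).ncard : ℤ) = Fintype.card F + ∑ x, gg (J x) * 1 := by
  rw [Set.ncard_eq_toFinset_card', Set.toFinset_ofPred, Finset.card_filter, Fintype.card_eq_sum_ones]
  push_cast
  rw [Finset.mul_sum, ← Finset.sum_add_distrib]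
  refine Finset.sum_congr rfl fun x _ => ?_
  simp only [gg]; split_ifs <;> simp

theorem count_N {F : Type} [Field F] [Fintype F] (hF : ringChar F ≠ 2) (J : F → ℕ) (s : F) :
    4 * (({x | J x < 4 ∧ IsSquare (x - s)} : Set F).ncard : ℤ) =
      Fintype.card F + 1 + ∑ x, gg (J x) * 1 + gg (J s) +
        ∑ x, gg (J x) * quadraticChar F (x - s) := by
  have h0 : ∑ x, quadraticChar F (x - s) = 0 := by
    rw [← quadraticChar_sum_zero hF]
    exact Fintype.sum_equiv (Equiv.subRight s) _ _ fun x => rfl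
  have h1 : ∑ x : F, (if x = s then (1 : ℤ) else 0) = 1 := by simp
  have h2 : ∑ x : F, (if x = s then gg (J s) else 0) = gg (J s) := by simp
  have e : (Fintype.card F : ℤ) = ∑ x : F, 1 := by simp
  have e2 : (Fintype.card F + 1 + ∑ x, gg (J x) * 1 + gg (J s) +
        ∑ x, gg (J x) * quadraticChar F (x - s) : ℤ) = 
      ∑ x : F, (1 + (if x = s then (1 : ℤ) else 0) + gg (J x) * 1 + (if x = s then gg (J s) else 0)
       + gg (J x) * quadraticChar F (x - s) + quadraticChar F (x - s)) := by
    simp only [Finset.sum_add_distrib]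
    rw [h0, h1, h2, e]; ring
  rw [e2, Set.ncard_eq_toFinset_card', Set.toFinset_ofPred, Finset.card_filter]
  push_cast
  rw [Finset.mul_sum]
  refine Finset.sum_congr rfl fun x _ => ?_
  by_cases hx : x = s
  · subst hx
    simp only [gg, sub_self, IsSquare.zero, and_true, if_true]
    split_ifs <;> simp
  · have hx' : x - s ≠ 0 := sub_ne_zero.mpr hx
    by_cases hsq : IsSquare (x - s)
    · rw [(quadraticChar_one_iff_isSquare hx').mpr hsq]
      simp only [gg, hx, hsq, and_true, if_false]
      split_ifs <;> simp
    · rw [quadraticChar_neg_one_iff_not_isSquare.mpr hsq]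
      simp only [gg, hx, hsq, and_false, if_false]
      split_ifs <;> simp

/-- combinatorial end game -/
theorem endgame {F : Type} [Field F] [Fintype F] (hF : ringChar F ≠ 2) (m : ℕ)
    (hcard : Fintype.card F = 4 * m ^ 2 + 4 * m + 3) {z : ℂ}
    (hz : z = Complex.exp (2 * Real.pi * Complex.I / 8)) (J : F → ℕ) (hJ : ∀ x, J x < 8)
    (H : ((∑ x, z ^ J x = 1 + z ^ 2 - (2 * m + 1) * z ^ 3) ∧
          (∀ s, ∑ x, z ^ J x * (quadraticChar F (x - s) : ℂ) =
            z + z ^ (5 * J s) * (z ^ 2 * (2 * m + 1) + z ^ 3 - z)) ∧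
          ∃ x, z ^ J x = z ^ 5 ∨ z ^ J x = - z ^ 5) ∨
         ((∑ x, z ^ J x = - (2 * m + 1) + z + z ^ 3) ∧
          (∀ s, ∑ x, z ^ J x * (quadraticChar F (x - s) : ℂ) =
            z ^ 2 + z ^ (5 * J s) * (z ^ 2 * (2 * m + 1) - z ^ 3 + z)) ∧
          ∃ x, z ^ J x = z ^ 6 ∨ z ^ J x = - z ^ 6)) :
    ({x | J x < 4} : Set F).ncard = 2 * m ^ 2 + m + 2 ∧
    (Set.range fun s : F => ({x | J x < 4 ∧ IsSquare (x - s)} : Set F).ncard) =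
        ({m ^ 2 + 1, m ^ 2 + 2, m ^ 2 + m + 1, m ^ 2 + m + 2} : Set ℕ) := by
  have h4 := z_four hz
  have hD := count_D J
  have hN := count_N hF J
  have inj : ∀ i j : ℕ, i < 8 → j < 8 → z ^ i = z ^ j → i = j := by
    intro i j hi hj hij
    rw [z_coord h4 i hi, z_coord h4 j hj] at hij
    have := z_indep hz (rr 0 i - rr 0 j) (rr 1 i - rr 1 j) (rr 2 i - rr 2 j) (rr 3 i - rr 3 j)
      (by push_cast; linear_combination hij)
    revert this
    interval_cases i <;> interval_cases j <;> simp [rr]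
  have p1 : z ^ 5 = - z := by linear_combination z * h4
  have p2 : z ^ 10 = z ^ 2 := by linear_combination z ^ 2 * (z ^ 4 - 1) * h4
  have p3 : z ^ 15 = - z ^ 3 := by linear_combination z ^ 3 * (z ^ 8 - z ^ 4 + 1) * h4
  have p4 : z ^ 20 = -1 := by
    linear_combination (z ^ 16 - z ^ 12 + z ^ 8 - z ^ 4 + 1) * h4
  have p5 : z ^ 25 = z := by
    linear_combination z * (z ^ 20 - z ^ 16 + z ^ 12 - z ^ 8 + z ^ 4 - 1) * h4
  have p6 : z ^ 30 = - z ^ 2 := by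
    linear_combination z ^ 2 * (z ^ 24 - z ^ 20 + z ^ 16 - z ^ 12 + z ^ 8 - z ^ 4 + 1) * h4
  have p7 : z ^ 35 = z ^ 3 := by
    linear_combination z ^ 3 * (z ^ 28 - z ^ 24 + z ^ 20 - z ^ 16 + z ^ 12 - z ^ 8 + z ^ 4 - 1) * h4
  rcases H with ⟨hS, hT, x0, hx0⟩ | ⟨hS, hT, x0, hx0⟩
  · have hS' : ∑ x, z ^ J x * ((1 : ℤ) : ℂ) = (1 : ℤ) + (0 : ℤ) * z + (1 : ℤ) * z ^ 2
        + (-(2 * m + 1) : ℤ) * z ^ 3 := by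
      push_cast; simp only [mul_one]; rw [hS]; ring
    have c := coord_sum hz J hJ (fun _ => 1) _ _ _ _ hS'
    have g := g_sum hz J hJ (fun _ => 1) _ _ _ _ hS'
    rw [g, hcard] at hD
    simp only [g, hcard] at hN
    push_cast at hD hN
    have T : ∀ s a b c d : _, z + z ^ (5 * J s) * (z ^ 2 * (2 * m + 1) + z ^ 3 - z) =
        (a : ℤ) + (b : ℤ) * z + (c : ℤ) * z ^ 2 + (d : ℤ) * z ^ 3 →
        ∑ x, gg (J x) * quadraticChar F (x - s) = a + b + c + d := by
      intro s a b c d e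
      exact g_sum hz J hJ _ a b c d ((hT s).trans e)
    have V : ∀ s j, J s = j → (({x | J x < 4 ∧ IsSquare (x - s)} : Set F).ncard) =
       if j = 1 then m ^ 2 + 2 else if j = 2 ∨ j = 4 ∨ j = 7 then m ^ 2 + 1 else
       if j = 5 then m ^ 2 + m + 1 else m ^ 2 + m + 2 := by
      intro s j hj
      have hj8 : j < 8 := hj ▸ hJ s
      have N := hN s
      have T' := T s
      rw [hj] at N T'
      interval_cases j
      · have T2 := T' (0) (0) ((2 * m + 1)) (1) (by
          simp only [Nat.reduceMul, pow_zero]; push_cast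
          linear_combination (0) * h4)
        rw [T2] at N
        simp [gg] at N ⊢
        refine Nat.cast_injective (R := ℤ) ?_
        push_cast
        linarith
      · have T2 := T' (1) (1) (1) (-(2 * m + 1)) (by
          simp only [Nat.reduceMul, p1]; push_cast
          linear_combination -(1) * h4)
        rw [T2] at N
        simp [gg] at N ⊢
        refine Nat.cast_injective (R := ℤ) ?_
        push_cast
        linarith
      · have T2 := T' (-(2 * m + 1)) (0) (0) (-1) (by
          simp only [Nat.reduceMul, p2]; push_cast
          linear_combination ((2 * m + 1) + z) * h4)
        rw [T2] at N
        simp [gg] at N ⊢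
        refine Nat.cast_injective (R := ℤ) ?_
        push_cast
        linarith
      · have T2 := T' (-1) ((2 * m + 1)+1) (1) (0) (by
          simp only [Nat.reduceMul, p3]; push_cast
          linear_combination -((2 * m + 1) * z + z ^ 2 - 1) * h4)
        rw [T2] at N
        simp [gg] at N ⊢
        refine Nat.cast_injective (R := ℤ) ?_
        push_cast
        linarith
      · have T2 := T' (0) (2) (-(2 * m + 1)) (-1) (by
          simp only [Nat.reduceMul, p4]; push_cast
          linear_combination -(0) * h4)
        rw [T2] at N
        simp [gg] at N ⊢
        refine Nat.cast_injective (R := ℤ) ?_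
        push_cast
        linarith
      · have T2 := T' (-1) (1) (-1) ((2 * m + 1)) (by
          simp only [Nat.reduceMul, p5]; push_cast
          linear_combination (1) * h4)
        rw [T2] at N
        simp [gg] at N ⊢
        refine Nat.cast_injective (R := ℤ) ?_
        push_cast
        linarith
      · have T2 := T' ((2 * m + 1)) (2) (0) (1) (by
          simp only [Nat.reduceMul, p6]; push_cast
          linear_combination -((2 * m + 1) + z) * h4)
        rw [T2] at N
        simp [gg] at N ⊢
        refine Nat.cast_injective (R := ℤ) ?_
        push_cast
        linarith
      · have T2 := T' (1) (1-(2 * m + 1)) (-1) (0) (by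
          simp only [Nat.reduceMul, p7]; push_cast
          linear_combination ((2 * m + 1) * z + z ^ 2 - 1) * h4)
        rw [T2] at N
        simp [gg] at N ⊢
        refine Nat.cast_injective (R := ℤ) ?_
        push_cast
        linarith
    have W := exists_both J 1 c.2.1 ⟨x0, by
      have p5 : - z ^ 5 = z ^ 1 := by linear_combination - z ^ 1 * h4
      rw [p5] at hx0
      rcases hx0 with hx0 | hx0
      · exact Or.inr (inj _ _ (hJ _) (by norm_num) hx0)
      · exact Or.inl (inj _ _ (hJ _) (by norm_num) hx0)⟩
    obtain ⟨⟨y1, hy1⟩, ⟨y2, hy2⟩⟩ := W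
    obtain ⟨y3, hy3⟩ := exists_of_pos J 0 c.1
    obtain ⟨y4, hy4⟩ := exists_of_pos J 2 c.2.2.1
    refine ⟨Nat.cast_injective (R := ℤ) (by push_cast; linarith), ?_⟩
    ext n
    simp only [Set.mem_range, Set.mem_insert_iff, Set.mem_singleton_iff]
    constructor
    · rintro ⟨s, rfl⟩
      rw [V s _ rfl]
      split_ifs <;> simp
    · rintro (rfl | rfl | rfl | rfl)
      · exact ⟨y4, by rw [V _ _ hy4]; simp⟩
      · exact ⟨y1, by rw [V _ _ hy1]; simp⟩
      · exact ⟨y2, by rw [V _ _ hy2]; simp⟩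
      · exact ⟨y3, by rw [V _ _ hy3]; simp⟩
  · have hS' : ∑ x, z ^ J x * ((1 : ℤ) : ℂ) = (-(2 * m + 1) : ℤ) + (1 : ℤ) * z + (0 : ℤ) * z ^ 2
        + (1 : ℤ) * z ^ 3 := by
      push_cast; simp only [mul_one]; rw [hS]; ring
    have c := coord_sum hz J hJ (fun _ => 1) _ _ _ _ hS'
    have g := g_sum hz J hJ (fun _ => 1) _ _ _ _ hS'
    rw [g, hcard] at hD
    simp only [g, hcard] at hN
    push_cast at hD hN
    have T : ∀ s a b c d : _, z ^ 2 + z ^ (5 * J s) * (z ^ 2 * (2 * m + 1) - z ^ 3 + z) =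
        (a : ℤ) + (b : ℤ) * z + (c : ℤ) * z ^ 2 + (d : ℤ) * z ^ 3 →
        ∑ x, gg (J x) * quadraticChar F (x - s) = a + b + c + d := by
      intro s a b c d e
      exact g_sum hz J hJ _ a b c d ((hT s).trans e)
    have V : ∀ s j, J s = j → (({x | J x < 4 ∧ IsSquare (x - s)} : Set F).ncard) =
       if j = 2 then m ^ 2 + 2 else if j = 1 ∨ j = 4 ∨ j = 7 then m ^ 2 + 1 else
       if j = 6 then m ^ 2 + m + 1 else m ^ 2 + m + 2 := by
      intro s j hj
      have hj8 : j < 8 := hj ▸ hJ s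
      have N := hN s
      have T' := T s
      rw [hj] at N T'
      interval_cases j
      · have T2 := T' (0) (1) ((2 * m + 1)+1) (-1) (by
          simp only [Nat.reduceMul, pow_zero]; push_cast
          linear_combination (0) * h4)
        rw [T2] at N
        simp [gg] at N ⊢
        refine Nat.cast_injective (R := ℤ) ?_
        push_cast
        linarith
      · have T2 := T' (-1) (0) (0) (-(2 * m + 1)) (by
          simp only [Nat.reduceMul, p1]; push_cast
          linear_combination -(-1) * h4)
        rw [T2] at N
        simp [gg] at N ⊢
        refine Nat.cast_injective (R := ℤ) ?_
        push_cast
        linarith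
      · have T2 := T' (-(2 * m + 1)) (1) (1) (1) (by
          simp only [Nat.reduceMul, p2]; push_cast
          linear_combination ((2 * m + 1) - z) * h4)
        rw [T2] at N
        simp [gg] at N ⊢
        refine Nat.cast_injective (R := ℤ) ?_
        push_cast
        linarith
      · have T2 := T' (1) ((2 * m + 1)) (0) (0) (by
          simp only [Nat.reduceMul, p3]; push_cast
          linear_combination -((2 * m + 1) * z - z ^ 2 + 1) * h4)
        rw [T2] at N
        simp [gg] at N ⊢
        refine Nat.cast_injective (R := ℤ) ?_
        push_cast
        linarith
      · have T2 := T' (0) (-1) (1-(2 * m + 1)) (1) (by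
          simp only [Nat.reduceMul, p4]; push_cast
          linear_combination -(0) * h4)
        rw [T2] at N
        simp [gg] at N ⊢
        refine Nat.cast_injective (R := ℤ) ?_
        push_cast
        linarith
      · have T2 := T' (1) (0) (2) ((2 * m + 1)) (by
          simp only [Nat.reduceMul, p5]; push_cast
          linear_combination (-1) * h4)
        rw [T2] at N
        simp [gg] at N ⊢
        refine Nat.cast_injective (R := ℤ) ?_
        push_cast
        linarith
      · have T2 := T' ((2 * m + 1)) (-1) (1) (-1) (by
          simp only [Nat.reduceMul, p6]; push_cast
          linear_combination -((2 * m + 1) - z) * h4)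
        rw [T2] at N
        simp [gg] at N ⊢
        refine Nat.cast_injective (R := ℤ) ?_
        push_cast
        linarith
      · have T2 := T' (-1) (-(2 * m + 1)) (2) (0) (by
          simp only [Nat.reduceMul, p7]; push_cast
          linear_combination ((2 * m + 1) * z - z ^ 2 + 1) * h4)
        rw [T2] at N
        simp [gg] at N ⊢
        refine Nat.cast_injective (R := ℤ) ?_
        push_cast
        linarith
    have W := exists_both J 2 c.2.2.1 ⟨x0, by
      have p5 : - z ^ 6 = z ^ 2 := by linear_combination - z ^ 2 * h4
      rw [p5] at hx0
      rcases hx0 with hx0 | hx0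
      · exact Or.inr (inj _ _ (hJ _) (by norm_num) hx0)
      · exact Or.inl (inj _ _ (hJ _) (by norm_num) hx0)⟩
    obtain ⟨⟨y1, hy1⟩, ⟨y2, hy2⟩⟩ := W
    obtain ⟨y3, hy3⟩ := exists_of_pos J 3 c.2.2.2
    obtain ⟨y4, hy4⟩ := exists_of_pos J 1 c.2.1
    refine ⟨Nat.cast_injective (R := ℤ) (by push_cast; linarith), ?_⟩
    ext n
    simp only [Set.mem_range, Set.mem_insert_iff, Set.mem_singleton_iff]
    constructor
    · rintro ⟨s, rfl⟩
      rw [V s _ rfl]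
      split_ifs <;> simp
    · rintro (rfl | rfl | rfl | rfl)
      · exact ⟨y4, by rw [V _ _ hy4]; simp⟩
      · exact ⟨y1, by rw [V _ _ hy1]; simp⟩
      · exact ⟨y2, by rw [V _ _ hy2]; simp⟩
      · exact ⟨y3, by rw [V _ _ hy3]; simp⟩

theorem sum_decomp {F F2 : Type} [Field F] [Fintype F] [Field F2] [Fintype F2] [Algebra F F2]
    (hc : Fintype.card F2 = Fintype.card F ^ 2) (θ : F2) (hθ : ∀ a : F, algebraMap F F2 a ≠ θ) :
    Function.Bijective (fun p : F × F => algebraMap F F2 p.1 + algebraMap F F2 p.2 * θ) := by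
  rw [Fintype.bijective_iff_injective_and_card]
  refine ⟨?_, by rw [Fintype.card_prod, hc, sq]⟩
  rintro ⟨a, b⟩ ⟨a', b'⟩ h
  simp only at h
  have hinj := (algebraMap F F2).injective
  by_cases hb : b = b'
  · subst hb
    have := hinj (add_right_cancel h)
    simp [this]
  · exfalso
    have hb' : algebraMap F F2 (b - b') ≠ 0 := by
      rw [Ne, map_eq_zero]; exact sub_ne_zero.mpr hb
    apply hθ ((a' - a) / (b - b'))
    rw [map_div₀, div_eq_iff hb']
    simp only [map_sub]
    linear_combination -h

theorem sum_lines {F F2 : Type} [Field F] [Fintype F] [Field F2] [Fintype F2] [Algebra F F2]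
    (hc : Fintype.card F2 = Fintype.card F ^ 2) (θ : F2) (hθ : ∀ a : F, algebraMap F F2 a ≠ θ)
    (f : F2 → ℂ) (h0 : f 0 = 0) :
    ∑ y, f y = ∑ x : F, ∑ c : F, f (algebraMap F F2 c * (1 + algebraMap F F2 x * θ)) +
      ∑ c : F, f (algebraMap F F2 c * θ) := by
  have e1 : ∑ y, f y = ∑ p : F × F, f (algebraMap F F2 p.1 + algebraMap F F2 p.2 * θ) :=
    (Fintype.sum_bijective _ (sum_decomp hc θ hθ) _ _ fun _ => rfl).symm
  rw [e1, Fintype.sum_prod_type]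
  simp only
  have : ∀ c : F, ∑ x : F, f (algebraMap F F2 c + algebraMap F F2 x * θ) =
      ∑ x : F, f (algebraMap F F2 c * (1 + algebraMap F F2 x * θ)) +
      if c = 0 then ∑ c : F, f (algebraMap F F2 c * θ) else 0 := by
    intro c
    by_cases hc0 : c = 0
    · subst hc0; simp [h0]
    · rw [if_neg hc0, add_zero]
      refine (Fintype.sum_equiv (Equiv.mulLeft₀ c hc0) _ _ fun x => ?_).symm
      change _ = f (algebraMap F F2 c + algebraMap F F2 (c * x) * θ)
      rw [map_mul]
      congr 1; ring
  rw [Finset.sum_congr rfl fun c _ => this c, Finset.sum_add_distrib]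
  rw [Finset.sum_comm]
  simp

theorem quadChar_eq {F : Type} [Field F] [Fintype F] (x : F) :
    quadChar F x = ((quadraticChar F x : ℤ) : ℂ) := by
  unfold quadChar
  by_cases hx : x = 0
  · subst hx; simp
  · rw [if_neg hx]
    split_ifs with hs
    · rw [(quadraticChar_one_iff_isSquare hx).mpr hs]; simp
    · rw [quadraticChar_neg_one_iff_not_isSquare.mpr hs]; simp

theorem gauss_ne {F : Type} [Field F] [Fintype F] (hF : ringChar F ≠ 2)
    (ψ : AddChar F ℂ) (hψ : ∃ a, ψ a ≠ 1) :
    (∑ x : F, ((quadraticChar F x : ℤ) : ℂ) * ψ x) ≠ 0 := by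
  have h1 : ψ ≠ 1 := by rintro rfl; simp at hψ
  have h2 : (quadraticChar F).ringHomComp (Int.castRingHom ℂ) ≠ 1 := by
    obtain ⟨a, ha⟩ := quadraticChar_exists_neg_one' hF
    intro h
    have := congrArg (fun c : MulChar F ℂ => c (a : F)) h
    simp [ha] at this
    norm_num at this
  exact gaussSum_ne_zero_of_nontrivial (by simp) h2 (AddChar.IsPrimitive.of_ne_one h1)

theorem gauss_shift {F : Type} [Field F] [Fintype F] (hF : ringChar F ≠ 2)
    (ψ : AddChar F ℂ) (a : F) :
    ∑ c : F, ((quadraticChar F c : ℤ) : ℂ) * ψ (c * a) =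
      ((quadraticChar F a : ℤ) : ℂ) * ∑ x : F, ((quadraticChar F x : ℤ) : ℂ) * ψ x := by
  by_cases ha : a = 0
  · subst ha
    simp only [mul_zero, AddChar.map_zero_eq_one, mul_one, quadraticChar_zero, Int.cast_zero,
      zero_mul]
    exact_mod_cast quadraticChar_sum_zero hF
  · rw [Finset.mul_sum]
    refine Fintype.sum_equiv (Equiv.mulRight₀ a ha) _ _ fun x => ?_
    change _ = _ * (((quadraticChar F (x * a) : ℤ) : ℂ) * ψ (x * a))
    rw [map_mul (quadraticChar F), Int.cast_mul]
    have : ((quadraticChar F a : ℤ) : ℂ) ^ 2 = 1 := by exact_mod_cast quadraticChar_sq_one ha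
    linear_combination - ((quadraticChar F x : ℤ) : ℂ) * ψ (x * a) * this

theorem eisen {F F2 : Type} [Field F] [Fintype F] [Field F2] [Fintype F2] [Algebra F F2]
    (hF : ringChar F ≠ 2)
    (hc : Fintype.card F2 = Fintype.card F ^ 2) (θ : F2) (hθ : ∀ a : F, algebraMap F F2 a ≠ θ)
    (ψ : AddChar F ℂ) (hψ : ∃ a, ψ a ≠ 1) (tr : F2 → F)
    (hlin : ∀ (c : F) (y : F2), tr (algebraMap F F2 c * y) = c * tr y)
    (χ : MulChar F2 ℂ) (hχ : ∀ c : F, χ (algebraMap F F2 c) = ((quadraticChar F c : ℤ) : ℂ))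
    (K : ℂ) (hG : (∑ y : F2, χ y * ψ (tr y)) =
      (∑ x : F, ((quadraticChar F x : ℤ) : ℂ) * ψ x) * K) (β : F2) (hβ : β ≠ 0) :
    χ β * (∑ x : F, χ (1 + algebraMap F F2 x * θ) *
        ((quadraticChar F (tr (β * (1 + algebraMap F F2 x * θ))) : ℤ) : ℂ)
      + χ θ * ((quadraticChar F (tr (β * θ)) : ℤ) : ℂ)) = K := by
  have hne := gauss_ne hF ψ hψ
  apply mul_left_cancel₀ hne
  rw [← hG]
  have e1 : (∑ y : F2, χ y * ψ (tr y)) = χ β * ∑ y : F2, χ y * ψ (tr (β * y)) := by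
    rw [Finset.mul_sum]
    refine (Fintype.sum_equiv (Equiv.mulLeft₀ β hβ) _ _ fun x => ?_).symm
    change _ = χ (β * x) * ψ (tr (β * x))
    rw [map_mul]; ring
  rw [e1, sum_lines hc θ hθ _ (by simp [MulChar.map_zero])]
  have e2 : ∀ u : F2, ∑ c : F, χ (algebraMap F F2 c * u) * ψ (tr (β * (algebraMap F F2 c * u))) =
      χ u * (((quadraticChar F (tr (β * u)) : ℤ) : ℂ) *
        ∑ x : F, ((quadraticChar F x : ℤ) : ℂ) * ψ x) := by
    intro u
    rw [← gauss_shift hF, Finset.mul_sum]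
    refine Finset.sum_congr rfl fun c _ => ?_
    rw [map_mul, hχ, show β * (algebraMap F F2 c * u) = algebraMap F F2 c * (β * u) by ring, hlin]
    ring
  simp only [e2]
  simp only [mul_add, Finset.mul_sum, Finset.sum_mul]
  congr 1
  · refine Finset.sum_congr rfl fun x _ => ?_
    rw [Finset.sum_congr rfl]
    intro i _; ring
  · rw [Finset.sum_congr rfl]
    intro i _; ring

theorem chi_F {F F2 : Type} [Field F] [Fintype F] [Field F2] [Fintype F2] [Algebra F F2]
    (q : ℕ) (hq8 : q % 8 = 3) (hF : Fintype.card F = q) (hF2 : Fintype.card F2 = q ^ 2)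
    (ω : F2ˣ) (hω : ∀ x : F2ˣ, x ∈ Subgroup.zpowers ω)
    (tr : F2 → F) (htr : ∀ x : F2, algebraMap F F2 (tr x) = x + x ^ q)
    (h2 : (2 : F2) ≠ 0)
    (χ : MulChar F2 ℂ) (h4 : χ (ω : F2) ^ 4 = -1) (c : F) :
    χ (algebraMap F F2 c) = ((quadraticChar F c : ℤ) : ℂ) := by
  by_cases hc : c = 0
  · subst hc; simp [MulChar.map_zero]
  have hc' : algebraMap F F2 c ≠ 0 := by rwa [Ne, map_eq_zero]
  have hord : orderOf ω = q ^ 2 - 1 := by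
    rw [orderOf_eq_card_of_forall_mem_zpowers hω, Nat.card_eq_fintype_card, Fintype.card_units, hF2]
  have main : ∀ a : F, a ≠ 0 → ∃ k : ℕ, algebraMap F F2 a = (ω : F2) ^ ((q + 1) * k) := by
    intro a ha
    have ha' : algebraMap F F2 a ≠ 0 := by rwa [Ne, map_eq_zero]
    obtain ⟨k, hk⟩ := (mem_powers_iff_mem_zpowers).mpr (hω (Units.mk0 _ ha'))
    simp only at hk
    have hk' : algebraMap F F2 a = (ω : F2) ^ k := by
      have := congrArg (fun u : F2ˣ => (u : F2)) hk
      simpa using this.symm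
    have h1 : a ^ (q - 1) = 1 := by rw [← hF]; exact FiniteField.pow_card_sub_one_eq_one a ha
    have h3 : ω ^ (k * (q - 1)) = 1 := by
      ext
      push_cast
      rw [pow_mul, ← hk', ← map_pow, h1, map_one]
    have h5 := orderOf_dvd_of_pow_eq_one h3
    rw [hord] at h5
    have : q ^ 2 - 1 = (q + 1) * (q - 1) := by
      rw [← Nat.sq_sub_sq]
    rw [this] at h5
    obtain ⟨j, hj⟩ := Nat.dvd_of_mul_dvd_mul_right (by omega) h5
    exact ⟨j, by rw [hk', hj]⟩
  have hval : ∀ k : ℕ, χ ((ω : F2) ^ ((q + 1) * k)) = (-1) ^ k := by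
    intro k
    rw [map_pow, pow_mul]
    have : q + 1 = 4 * (2 * (q / 8) + 1) := by omega
    rw [this, pow_mul, h4, pow_succ, pow_mul]; simp
  obtain ⟨k, hk⟩ := main c hc
  rw [hk, hval]
  rcases Nat.even_or_odd k with hev | hodd
  · rw [hev.neg_one_pow]
    have : IsSquare c := by
      obtain ⟨j, hj⟩ := hev
      have hb : ((ω : F2) ^ ((q + 1) * j)) ^ q = (ω : F2) ^ ((q + 1) * j) := by
        have hq1 : 1 ≤ q := by omega
        have e : (q + 1) * j * q = (q + 1) * j + (q ^ 2 - 1) * j := by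
          have : 1 ≤ q ^ 2 := Nat.one_le_pow _ _ (by omega)
          zify [this]; ring
        rw [← pow_mul, e, pow_add, pow_mul _ (q ^ 2 - 1)]
        have : (ω : F2) ^ (q ^ 2 - 1) = 1 := by
          have := pow_orderOf_eq_one ω
          rw [hord] at this
          rw [← Units.val_pow_eq_pow_val, this, Units.val_one]
        rw [this]; simp
      have ht := htr ((ω : F2) ^ ((q + 1) * j))
      rw [hb] at ht
      refine ⟨tr ((ω : F2) ^ ((q + 1) * j)) / 2, (algebraMap F F2).injective ?_⟩
      have h2' : algebraMap F F2 2 = 2 := map_ofNat _ 2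
      rw [map_mul, map_div₀, ht, h2', hk, hj]
      field_simp
      ring
    rw [(quadraticChar_one_iff_isSquare hc).mpr this]; simp
  · rw [hodd.neg_one_pow]
    have : ¬ IsSquare c := by
      rintro ⟨d, hd⟩
      have hd0 : d ≠ 0 := by rintro rfl; simp at hd; exact hc hd
      obtain ⟨j, hj⟩ := main d hd0
      have : χ (algebraMap F F2 c) = 1 := by
        rw [hd, map_mul, map_mul, hj, hval, ← mul_pow]; simp
      rw [hk, hval, hodd.neg_one_pow] at this
      norm_num at this
    rw [quadraticChar_neg_one_iff_not_isSquare.mpr this]; simp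

theorem algT1 {z P A T Th M d : ℂ} (h4 : z ^ 4 = -1) (hP : P ^ 8 = 1) (hd : d ^ 2 = 1)
    (hA : A ^ 4 = 1) (hTh : Th = A * z ^ 5)
    (hE : (A * P) ^ 3 * (-(d * z ^ 2)) * (A * T + Th) = d * M + d * (z + z ^ 3)) :
    T = z + P ^ 5 * (z ^ 2 * M + z ^ 3 - z) := by
  subst hTh
  have h1 : -d * P ^ 3 * z ^ 2 * (T + z ^ 5) = d * (M + z + z ^ 3) := by
    linear_combination hE - (-d * P ^ 3 * z ^ 2 * (T + z ^ 5)) * hA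
  have h2 : - P ^ 3 * z ^ 2 * (T + z ^ 5) = M + z + z ^ 3 := by
    linear_combination d * h1 - (- P ^ 3 * z ^ 2 * (T + z ^ 5) - (M + z + z ^ 3)) * hd
  linear_combination z ^ 2 * P ^ 5 * h2 + (T + z ^ 5) * P ^ 8 * h4 - (T + z ^ 5) * hP
    + (P ^ 5 * z - z) * h4

theorem algT2 {z P A T Th M d : ℂ} (h4 : z ^ 4 = -1) (hP : P ^ 8 = 1) (hd : d ^ 2 = 1)
    (hA : A ^ 4 = -1) (hTh : Th = A * z ^ 6)
    (hE : (A * P) ^ 3 * (-(d * z ^ 2)) * (A * T + Th) = -d * M + d * (z + z ^ 3)) :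
    T = z ^ 2 + P ^ 5 * (z ^ 2 * M - z ^ 3 + z) := by
  subst hTh
  have h1 : d * P ^ 3 * z ^ 2 * (T + z ^ 6) = d * (-M + z + z ^ 3) := by
    linear_combination hE - (-d * P ^ 3 * z ^ 2 * (T + z ^ 6)) * hA
  have h2 : P ^ 3 * z ^ 2 * (T + z ^ 6) = -M + z + z ^ 3 := by
    linear_combination d * h1 - (P ^ 3 * z ^ 2 * (T + z ^ 6) - (-M + z + z ^ 3)) * hd
  linear_combination -z ^ 2 * P ^ 5 * h2 + (T + z ^ 6) * P ^ 8 * h4 - (T + z ^ 6) * hP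
    - (P ^ 5 * z + z ^ 2) * h4

theorem algS1 {z A S Th M d : ℂ} (h4 : z ^ 4 = -1) (hd : d ^ 2 = 1)
    (hA : A ^ 4 = 1) (hTh : Th = A * z ^ 5)
    (hE : Th ^ 3 * (-(d * z ^ 2)) * (-(A * S)) = d * M + d * (z + z ^ 3)) :
    S = 1 + z ^ 2 - M * z ^ 3 := by
  subst hTh
  have h1 : z ^ 17 * d * S = d * (M + z + z ^ 3) := by
    linear_combination hE - (z ^ 17 * d * S) * hA
  have hz : z ^ 17 = z := by
    linear_combination z * (z ^ 4 - 1) * (z ^ 8 + 1) * h4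
  rw [hz] at h1
  have h2 : z * S = M + z + z ^ 3 := by
    linear_combination d * h1 - (z * S - (M + z + z ^ 3)) * hd
  linear_combination -z ^ 3 * h2 + (S - 1 - z ^ 2) * h4

theorem algS2 {z A S Th M d : ℂ} (h4 : z ^ 4 = -1) (hd : d ^ 2 = 1)
    (hA : A ^ 4 = -1) (hTh : Th = A * z ^ 6)
    (hE : Th ^ 3 * (-(d * z ^ 2)) * (-(A * S)) = -d * M + d * (z + z ^ 3)) :
    S = -M + z + z ^ 3 := by
  subst hTh
  have h1 : -(z ^ 20) * d * S = d * (-M + z + z ^ 3) := by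
    linear_combination hE - (z ^ 20 * d * S) * hA
  have hz : z ^ 20 = -1 := by
    linear_combination (z ^ 16 - z ^ 12 + z ^ 8 - z ^ 4 + 1) * h4
  rw [hz] at h1
  linear_combination d * h1 - (S - (-M + z + z ^ 3)) * hd

/-- the four-intersection set of Theorem 4.2 of the paper. -/
theorem stmt_10 (m q : ℕ) (hm : 0 < m) (hq : q = 4 * m ^ 2 + 4 * m + 3) (hqpp : IsPrimePow q)
    (F F2 : Type) [Field F] [Fintype F] [Field F2] [Fintype F2] [Algebra F F2]
    (hF : Fintype.card F = q) (hF2 : Fintype.card F2 = q ^ 2)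
    (ω : F2ˣ) (hω : ∀ x : F2ˣ, x ∈ Subgroup.zpowers ω)
    (ψ : AddChar F ℂ) (hψ : ∃ a, ψ a ≠ 1)
    (tr : F2 → F) (htr : ∀ x : F2, algebraMap F F2 (tr x) = x + x ^ q)
    (χ : MulChar F2 ℂ)
    (hχω : χ (ω : F2) = Complex.exp (2 * Real.pi * Complex.I / 8))
    (ε δ : ℤ) (hε : ε = 1 ∨ ε = -1) (hδ : δ = 1 ∨ δ = -1)
    (hGauss : (∑ y : F2, χ y * ψ (tr y)) =
      (∑ x : F, quadChar F x * ψ x) *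
        ((ε : ℂ) * (2 * m + 1) + (δ : ℂ) * Complex.I * Real.sqrt 2))
    (h' : ℕ) (hh' : h' < 4)
    (h : ℤ) (hh : h = 2 * h' + (1 - ε * δ) / 2)
    (ℓ : ℤ)
    (hχℓ : χ ((ω ^ ℓ : F2ˣ) : F2) =
      Complex.exp (2 * Real.pi * Complex.I / 8) ^ (2 - 5 * ε * δ - 6 * (h' : ℤ)))
    (hχd : χ (((ω ^ (ℓ * (q : ℤ)) : F2ˣ) : F2) - ((ω ^ ℓ : F2ˣ) : F2)) = -(Complex.I ^ δ))
    (C₀ : Set F) (hC₀ : C₀ = {x : F | x ≠ 0 ∧ IsSquare x})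
    (D : Set F)
    (hD : D = {x : F | ∃ i ∈ ({h, h + 1, h + 2, h + 3} : Finset ℤ),
      (1 + algebraMap F F2 x * ((ω ^ ℓ : F2ˣ) : F2)) ∈ cyc ω 8 i}) :
    D.ncard = 2 * m ^ 2 + m + 2 ∧
      (Set.range fun s : F => (D ∩ ((fun x => x + s) '' (C₀ ∪ {0}))).ncard) =
        ({m ^ 2 + 1, m ^ 2 + 2, m ^ 2 + m + 1, m ^ 2 + m + 2} : Set ℕ) := by
  classical
  obtain ⟨z, hz⟩ : ∃ z, z = Complex.exp (2 * Real.pi * Complex.I / 8) := ⟨_, rfl⟩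
  rw [← hz] at hχω hχℓ
  have h4 := z_four hz
  have hz0 : z ≠ 0 := by rintro rfl; norm_num at h4
  have hq8 : q % 8 = 3 := by
    have : m ^ 2 + m = m * (m + 1) := by ring
    obtain ⟨t, ht⟩ := Nat.even_mul_succ_self m
    rw [← this] at ht
    omega
  have hq11 : 11 ≤ q := by nlinarith
  have hcF : ringChar F ≠ 2 := by
    rw [Ne, FiniteField.even_card_iff_char_two, hF]; omega
  have hcF2 : ringChar F2 ≠ 2 := by
    rw [Ne, FiniteField.even_card_iff_char_two, hF2, Nat.pow_mod]
    have : q % 2 = 1 := by omega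
    rw [this]; norm_num
  have h2 : (2 : F2) ≠ 0 := Ring.two_ne_zero hcF2
  have hord : orderOf ω = q ^ 2 - 1 := by
    rw [orderOf_eq_card_of_forall_mem_zpowers hω, Nat.card_eq_fintype_card, Fintype.card_units, hF2]
  have h8 : (8 : ℤ) ∣ (orderOf ω : ℤ) := by
    rw [hord]
    have : 8 ∣ q ^ 2 - 1 := by
      have e : q = 8 * (q / 8) + 3 := by omega
      rw [e]
      refine ⟨8 * (q / 8) ^ 2 + 6 * (q / 8) + 1, ?_⟩
      have : (8 * (q / 8) + 3) ^ 2 = 8 * (8 * (q / 8) ^ 2 + 6 * (q / 8) + 1) + 1 := by ring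
      omega
    exact_mod_cast this
  have hinj := (algebraMap F F2).injective
  have hcard : Fintype.card F2 = Fintype.card F ^ 2 := by rw [hF, hF2]
  have hχF := chi_F q hq8 hF hF2 ω hω tr htr h2 χ (by rw [hχω]; exact h4)
  -- Frobenius
  obtain ⟨φ, hφ⟩ : ∃ φ : F2 →ₐ[F] F2, ∀ y, φ y = y ^ q :=
    ⟨FiniteField.frobeniusAlgHom F F2, fun y => by rw [← hF]; rfl⟩
  have hφφ : ∀ y, φ (φ y) = y := by
    intro y; rw [hφ, hφ, ← pow_mul, ← sq, ← hF2]; exact FiniteField.pow_card y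
  have htr' : ∀ y, algebraMap F F2 (tr y) = y + φ y := fun y => by rw [htr, hφ]
  have hlin : ∀ (c : F) (y : F2), tr (algebraMap F F2 c * y) = c * tr y := by
    intro c y
    apply hinj
    rw [map_mul, htr', htr', map_mul, AlgHom.commutes]; ring
  have hχz : ∀ k : ℤ, χ ((ω ^ k : F2ˣ) : F2) = z ^ k := by
    intro k
    rw [← MulChar.coe_toUnitHom, map_zpow, Units.val_zpow_eq_zpow_val, MulChar.coe_toUnitHom, hχω]
  have hall : ∀ y : F2, y ≠ 0 → ∃ k : ℤ, y = ((ω ^ k : F2ˣ) : F2) := by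
    intro y hy
    obtain ⟨k, hk⟩ := Subgroup.mem_zpowers_iff.mp (hω (Units.mk0 y hy))
    exact ⟨k, by rw [hk]; rfl⟩
  have hz8 : z ^ (8 : ℤ) = 1 := by
    have : z ^ (8 : ℕ) = 1 := by linear_combination (z ^ 4 - 1) * h4
    exact_mod_cast this
  have hzmod : ∀ a b : ℤ, (8 : ℤ) ∣ a - b → z ^ a = z ^ b := by
    rintro a b ⟨c, hc⟩
    have : a = b + 8 * c := by omega
    rw [this, zpow_add₀ hz0, zpow_mul, hz8]; simp
  have hχ8 : ∀ y : F2, y ≠ 0 → χ y ^ 8 = 1 := by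
    intro y hy
    obtain ⟨k, rfl⟩ := hall y hy
    rw [hχz, ← zpow_natCast, ← zpow_mul, mul_comm, zpow_mul]
    have : z ^ ((8 : ℕ) : ℤ) = 1 := hz8
    rw [this]; simp
  have hχφ : ∀ y : F2, y ≠ 0 → χ (φ y) = χ y ^ 3 := by
    intro y hy
    have : q = 8 * (q / 8) + 3 := by omega
    rw [hφ, map_pow, this, pow_add, pow_mul, hχ8 y hy]; simp
  obtain ⟨θ, hθdef⟩ : ∃ θ : F2, θ = ((ω ^ ℓ : F2ˣ) : F2) := ⟨_, rfl⟩
  have hθq : ((ω ^ (ℓ * (q : ℤ)) : F2ˣ) : F2) = φ θ := by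
    rw [hφ, hθdef, zpow_mul, zpow_natCast, Units.val_pow_eq_pow_val]
  have hθ0 : θ ≠ 0 := by rw [hθdef]; exact Units.ne_zero _
  rw [hθq, ← hθdef] at hχd
  rw [← hθdef] at hχℓ
  have hD' : D = {x : F | ∃ i ∈ ({h, h + 1, h + 2, h + 3} : Finset ℤ),
      (1 + algebraMap F F2 x * θ) ∈ cyc ω 8 i} := by rw [hD, hθdef]
  obtain ⟨κ, hκ⟩ : ∃ κ, κ = φ θ - θ := ⟨_, rfl⟩
  rw [← hκ] at hχd
  have hz2 := z_sq hz
  have hd2 : ((δ : ℤ) : ℂ) ^ 2 = 1 := by rcases hδ with rfl | rfl <;> norm_num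
  have hχκ : χ κ = -((δ : ℂ) * z ^ 2) := by
    rw [hχd, hz2]; rcases hδ with rfl | rfl <;> simp
  have hκ0 : κ ≠ 0 := by
    rintro rfl
    rw [MulChar.map_zero] at hχκ
    have : (δ : ℂ) * z ^ 2 = 0 := by linear_combination hχκ
    rcases hδ with rfl | rfl <;> simp [hz0] at this
  have hθF : ∀ a : F, algebraMap F F2 a ≠ θ := by
    rintro a ha
    apply hκ0
    rw [hκ, ← ha, AlgHom.commutes, sub_self]
  have hφκ : φ κ = -κ := by rw [hκ, map_sub, hφφ]; ring
  have hne : ∀ x : F, 1 + algebraMap F F2 x * θ ≠ 0 := by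
    intro x hx
    have hb := (sum_decomp hcard θ hθF).injective
    have : ((1, x) : F × F) = (0, 0) := hb (by simpa using hx)
    simp at this
  -- the element n
  obtain ⟨n, hn⟩ : ∃ n : F, algebraMap F F2 n = -κ ^ 2 := ⟨tr (κ * θ), by
    rw [htr', map_mul, hφκ]; rw [hκ]; ring⟩
  have hηneg : quadraticChar F (-1) = -1 := by
    rw [quadraticChar_neg_one_iff_not_isSquare, FiniteField.isSquare_neg_one_iff, hF]; omega
  have hηn : quadraticChar F n = 1 := by
    have e1 := hχF n
    have e2 := hχF (-1)
    rw [hηneg, map_neg, map_one] at e2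
    rw [hn, neg_eq_neg_one_mul, map_mul, map_pow, e2, hχκ] at e1
    have : ((quadraticChar F n : ℤ) : ℂ) = 1 := by
      rw [← e1]; push_cast
      linear_combination -z ^ 4 * hd2 - h4
    exact_mod_cast this
  have hηn' : quadraticChar F (-n) = -1 := by
    rw [neg_eq_neg_one_mul, map_mul, hηn, hηneg]; norm_num
  -- K
  have hG : (∑ y : F2, χ y * ψ (tr y)) =
      (∑ x : F, ((quadraticChar F x : ℤ) : ℂ) * ψ x) *
        ((ε : ℂ) * (2 * m + 1) + (δ : ℂ) * (z + z ^ 3)) := by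
    rw [hGauss, z_sqrt hz]
    simp only [quadChar_eq]
    congr 1; ring
  have E := eisen hcF hcard θ hθF ψ hψ tr hlin χ hχF _ hG
  -- class index
  choose k hk using fun x : F => hall _ (hne x)
  obtain ⟨J, hJdef⟩ : ∃ J : F → ℕ, ∀ x, (J x : ℤ) = (k x - h) % 8 :=
    ⟨fun x => ((k x - h) % 8).toNat, fun x => Int.toNat_of_nonneg (Int.emod_nonneg _ (by norm_num))⟩
  have hJ : ∀ x, J x < 8 := by
    intro x
    have := hJdef x
    omega
  obtain ⟨A, hA⟩ : ∃ A, A = z ^ h := ⟨_, rfl⟩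
  have hA0 : A ≠ 0 := by rw [hA]; exact zpow_ne_zero _ hz0
  have hχJ : ∀ x : F, χ (1 + algebraMap F F2 x * θ) = A * z ^ J x := by
    intro x
    rw [hk, hχz, hA, ← zpow_natCast, ← zpow_add₀ hz0]
    apply hzmod
    have := hJdef x
    omega
  have hmem : ∀ x : F, x ∈ D ↔ J x < 4 := by
    intro x
    rw [hD', Set.mem_ofPred_eq]
    have hj := hJdef x
    constructor
    · rintro ⟨i, hi, t, ht⟩
      rw [hk] at ht
      have ht' := Units.ext ht
      rw [zpow_eq_zpow_iff_modEq] at ht'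
      have := dvd_trans h8 ht'.dvd
      simp only [Finset.mem_insert, Finset.mem_singleton] at hi
      push_cast at this
      omega
    · intro hx
      refine ⟨h + J x, ?_, (k x - h) / 8, ?_⟩
      · simp only [Finset.mem_insert, Finset.mem_singleton]; omega
      · rw [hk]
        congr 2
        push_cast; omega
  have ET : ∀ s : F, (A * z ^ J s) ^ 3 * (-((δ : ℂ) * z ^ 2)) *
      (A * ∑ x, z ^ J x * ((quadraticChar F (x - s) : ℤ) : ℂ) + χ θ) =
      (ε : ℂ) * (2 * m + 1) + (δ : ℂ) * (z + z ^ 3) := by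
    intro s
    have e := E (φ (1 + algebraMap F F2 s * θ) * κ)
      (mul_ne_zero (by rw [hφ]; exact pow_ne_zero _ (hne s)) hκ0)
    have t1 : ∀ x : F, tr (φ (1 + algebraMap F F2 s * θ) * κ * (1 + algebraMap F F2 x * θ)) =
        n * (x - s) := by
      intro x
      apply hinj
      rw [htr', map_mul (algebraMap F F2), hn, map_mul φ, map_mul φ, hφφ, hφκ]
      simp only [map_add, map_mul, map_one, AlgHom.commutes, map_sub]
      rw [hκ]; ring
    have t2 : tr (φ (1 + algebraMap F F2 s * θ) * κ * θ) = n := by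
      apply hinj
      rw [htr', hn, map_mul φ, map_mul φ, hφφ, hφκ]
      simp only [map_add, map_mul, map_one, AlgHom.commutes]
      rw [hκ]; ring
    simp only [t1, t2, map_mul (quadraticChar F), hηn, one_mul, Int.cast_one, mul_one] at e
    rw [map_mul, hχφ _ (hne s), hχκ, hχJ] at e
    rw [← e, Finset.mul_sum]
    congr 2
    refine Finset.sum_congr rfl fun x _ => ?_
    rw [hχJ]; ring
  have ES : χ θ ^ 3 * (-((δ : ℂ) * z ^ 2)) * (-(A * ∑ x, z ^ J x)) =
      (ε : ℂ) * (2 * m + 1) + (δ : ℂ) * (z + z ^ 3) := by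
    have e := E (φ θ * κ) (mul_ne_zero (by rw [hφ]; exact pow_ne_zero _ hθ0) hκ0)
    have t1 : ∀ x : F, tr (φ θ * κ * (1 + algebraMap F F2 x * θ)) = -n := by
      intro x
      apply hinj
      rw [htr', map_neg, hn, map_mul φ, map_mul φ, hφφ, hφκ]
      simp only [map_add, map_mul, map_one, AlgHom.commutes]
      rw [hκ]; ring
    have t2 : tr (φ θ * κ * θ) = 0 := by
      apply hinj
      rw [htr', map_zero, map_mul φ, map_mul φ, hφφ, hφκ]
      ring
    simp only [t1, t2, hηn', quadraticChar_zero, Int.cast_zero, mul_zero, add_zero] at e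
    rw [map_mul, hχφ _ hθ0, hχκ] at e
    rw [← e, Finset.mul_sum, ← Finset.sum_neg_distrib]
    congr 1
    refine Finset.sum_congr rfl fun x _ => ?_
    rw [hχJ]; push_cast; ring
  have Ex : ∃ x : F, A * z ^ J x = χ θ ∨ A * z ^ J x = - χ θ := by
    obtain ⟨⟨a, b⟩, hab⟩ := (sum_decomp hcard θ hθF).surjective (θ * (ω : F2) ^ 4)
    simp only at hab
    have ha : a ≠ 0 := by
      rintro rfl
      have e1 : (ω : F2) ^ 4 = algebraMap F F2 b := by
        apply mul_left_cancel₀ hθ0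
        rw [← hab, map_zero]; ring
      have e2 : φ ((ω : F2) ^ 4) = (ω : F2) ^ 4 := by rw [e1, AlgHom.commutes]
      rw [hφ, ← pow_mul] at e2
      have e3 : ω ^ (4 * q) = ω ^ 4 := by ext; push_cast; exact e2
      rw [pow_eq_pow_iff_modEq, hord] at e3
      have e4 := (Nat.modEq_iff_dvd' (by omega)).mp e3.symm
      have e5 := Nat.le_of_dvd (by omega) e4
      have : 4 * q + 1 ≤ q ^ 2 := by nlinarith
      omega
    have ha' : algebraMap F F2 a ≠ 0 := by rwa [Ne, map_eq_zero]
    refine ⟨b / a, ?_⟩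
    have e1 : algebraMap F F2 a * (1 + algebraMap F F2 (b / a) * θ) = θ * (ω : F2) ^ 4 := by
      rw [← hab, map_div₀]; field_simp
    have e2 := congrArg χ e1
    rw [map_mul, map_mul, map_pow, hχω, h4, hχF, hχJ] at e2
    rcases quadraticChar_dichotomy ha with h1 | h1
    · right; rw [h1] at e2; push_cast at e2; linear_combination e2
    · left; rw [h1] at e2; push_cast at e2; linear_combination -e2
  have hP8 : ∀ s, (z ^ J s) ^ 8 = 1 := by
    intro s
    have : z ^ 8 = 1 := by exact_mod_cast hz8
    rw [← pow_mul, mul_comm, pow_mul, this, one_pow]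
  have hP5 : ∀ s, z ^ (5 * J s) = (z ^ J s) ^ 5 := by
    intro s; rw [mul_comm, pow_mul]
  have H := endgame hcF m (by rw [hF, hq]) hz J hJ (by
    have hcase : (ε = δ ∧ ε * δ = 1) ∨ (ε = -δ ∧ ε * δ = -1) := by
      rcases hε with rfl | rfl <;> rcases hδ with rfl | rfl <;> simp
    rcases hcase with ⟨hu, hu'⟩ | ⟨hu, hu'⟩
    · left
      rw [mul_assoc 5, hu'] at hχℓ
      rw [hu'] at hh
      norm_num at hh
      have A4 : A ^ 4 = 1 := by
        rw [hA, ← zpow_natCast, ← zpow_mul, ← zpow_zero z]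
        apply hzmod; push_cast; omega
      have hTh : χ θ = A * z ^ 5 := by
        rw [hχℓ, hA, ← zpow_natCast, ← zpow_add₀ hz0]
        apply hzmod; push_cast; omega
      rw [hu] at ET ES
      refine ⟨algS1 h4 hd2 A4 hTh ES, fun s => ?_, ?_⟩
      · rw [hP5]
        exact algT1 h4 (hP8 s) hd2 A4 hTh (ET s)
      · obtain ⟨x, hx⟩ := Ex
        refine ⟨x, ?_⟩
        rw [hTh] at hx
        rcases hx with hx | hx
        · exact Or.inl (mul_left_cancel₀ hA0 hx)
        · exact Or.inr (mul_left_cancel₀ hA0 (by rw [hx]; ring))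
    · right
      rw [mul_assoc 5, hu'] at hχℓ
      rw [hu'] at hh
      norm_num at hh
      have A4 : A ^ 4 = -1 := by
        rw [hA, ← zpow_natCast, ← zpow_mul, ← h4, ← zpow_natCast z 4]
        apply hzmod; push_cast; omega
      have hTh : χ θ = A * z ^ 6 := by
        rw [hχℓ, hA, ← zpow_natCast, ← zpow_add₀ hz0]
        apply hzmod; push_cast; omega
      rw [hu] at ET ES
      push_cast at ET ES
      refine ⟨algS2 h4 hd2 A4 hTh ES, fun s => ?_, ?_⟩
      · rw [hP5]
        exact algT2 h4 (hP8 s) hd2 A4 hTh (ET s)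
      · obtain ⟨x, hx⟩ := Ex
        refine ⟨x, ?_⟩
        rw [hTh] at hx
        rcases hx with hx | hx
        · exact Or.inl (mul_left_cancel₀ hA0 hx)
        · exact Or.inr (mul_left_cancel₀ hA0 (by rw [hx]; ring)))
  have hDset : D = {x | J x < 4} := by ext x; exact hmem x
  have hNset : ∀ s : F, D ∩ ((fun x => x + s) '' (C₀ ∪ {0})) =
      {x | J x < 4 ∧ IsSquare (x - s)} := by
    intro s
    ext x
    rw [hDset, hC₀]
    simp only [Set.mem_inter_iff, Set.mem_ofPred_eq, Set.mem_image, Set.mem_union,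
      Set.mem_singleton_iff]
    refine and_congr_right fun _ => ?_
    constructor
    · rintro ⟨y, hy, rfl⟩
      rw [add_sub_cancel_right]
      rcases hy with hy | rfl
      · exact hy.2
      · exact IsSquare.zero
    · intro hx
      refine ⟨x - s, ?_, by ring⟩
      by_cases h0 : x - s = 0
      · exact Or.inr h0
      · exact Or.inl ⟨h0, hx⟩
  simp only [hNset]
  rw [hDset]
  exact H
end
end

section
/- Let m be a positive integer such that q = 2m² + 2m + 1 is a prime power, let χ₄ be a multiplicative character of order 4 of F_{q²} with values in ℂ, let η be the quadratic character of F_q, let ψ be a nontrivial additive character of F_q and ψ' := ψ∘Tr_{F_{q²}/F_q}. Then there exist ε, δ ∈ {1, −1} such that, in ℂ, G_q(η)·G_{q²}(χ₄)/q = εm + δ(m+1)·i if m is odd, and G_q(η)·G_{q²}(χ₄)/q = ε(m+1) + δm·i if m is even. -/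
noncomputable section

open Complex

theorem aux_arith (A B : ℤ) (m p n : ℕ) (hp : p.Prime) (hn : n ≠ 0)
    (hq : p ^ n = 2 * m ^ 2 + 2 * m + 1) (hAB : A ^ 2 + B ^ 2 = (p : ℤ) ^ n)
    (hd : ¬ ((p : ℤ) ∣ A ∧ (p : ℤ) ∣ B)) :
    ((A = m ∨ A = -m) ∧ (B = m + 1 ∨ B = -(m + 1))) ∨
    ((A = m + 1 ∨ A = -(m + 1)) ∧ (B = m ∨ B = - m)) := by
  have hpp : Prime (p : ℤ) := Nat.prime_iff_prime_int.mp hp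
  have hqZ : (p : ℤ) ^ n = 2 * (m : ℤ) ^ 2 + 2 * m + 1 := by exact_mod_cast hq
  set Q : ℤ := (p : ℤ) ^ n with hQ
  set M : ℤ := (m : ℤ) with hM
  have hM0 : 0 ≤ M := by positivity
  have hpQ : (p : ℤ) ∣ Q := dvd_pow_self _ hn
  have hp2 : ¬ (p : ℤ) ∣ 2 := by
    intro h
    have h1 : (p : ℤ) ∣ 1 := by
      have : (1 : ℤ) = Q - 2 * (M ^ 2 + M) := by rw [hqZ]; ring
      rw [this]
      exact dvd_sub hpQ (h.mul_right _)
    exact hpp.not_isUnit (isUnit_of_dvd_one h1)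
  have hpM : ¬ (p : ℤ) ∣ M := by
    intro h
    have h1 : (p : ℤ) ∣ 1 := by
      have : (1 : ℤ) = Q - M * (2 * M + 2) := by rw [hqZ]; ring
      rw [this]
      exact dvd_sub hpQ (h.mul_right _)
    exact hpp.not_isUnit (isUnit_of_dvd_one h1)
  have hpM1 : ¬ (p : ℤ) ∣ M + 1 := by
    intro h
    have h1 : (p : ℤ) ∣ 1 := by
      have : (1 : ℤ) = Q - (M + 1) * (2 * M) := by rw [hqZ]; ring
      rw [this]
      exact dvd_sub hpQ (h.mul_right _)
    exact hpp.not_isUnit (isUnit_of_dvd_one h1)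
  have hQpos : 0 < Q := by rw [hqZ]; positivity
  -- general claim
  have key : ∀ B : ℤ, A ^ 2 + B ^ 2 = Q → Q ∣ A * (M + 1) - B * M →
     ((A = M ∨ A = -M) ∧ (B = M + 1 ∨ B = -(M + 1))) ∨
     ((A = M + 1 ∨ A = -(M + 1)) ∧ (B = M ∨ B = - M)) := by
    intro B hAB ⟨c, hc⟩
    have e : (A * (M + 1) - B * M) ^ 2 + (A * M + B * (M + 1)) ^ 2 = Q ^ 2 := by
      have : (A * (M + 1) - B * M) ^ 2 + (A * M + B * (M + 1)) ^ 2
        = (A ^ 2 + B ^ 2) * (2 * M ^ 2 + 2 * M + 1) := by ring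
      rw [this, hAB, ← hqZ]; ring
    have hc1 : c ^ 2 ≤ 1 := by
      rw [hc] at e
      have : Q ^ 2 * c ^ 2 ≤ Q ^ 2 * 1 := by nlinarith [sq_nonneg (A * M + B * (M + 1))]
      exact le_of_mul_le_mul_left this (by positivity)
    have hc2 : -1 ≤ c := by nlinarith
    have hc3 : c ≤ 1 := by nlinarith
    have sol : ∀ x y : ℤ, Q * x = Q * y → x = y := fun x y h => mul_left_cancel₀ hQpos.ne' h
    have hcase : c = 0 ∨ c ^ 2 = 1 := by
      interval_cases c <;> simp
    rcases hcase with h0 | h1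
    · subst h0
      left
      have e0 : A * (M + 1) = B * M := by linarith
      -- Q * A^2 = Q * M^2
      have hA : A ^ 2 = M ^ 2 := by
        apply sol
        have : (A * (M+1)) ^ 2 = (B * M) ^ 2 := by rw [e0]
        have hB : B ^ 2 = Q - A ^ 2 := by linarith
        rw [mul_pow, mul_pow, hB] at this
        linear_combination this + A ^ 2 * hqZ
      have hB : B ^ 2 = (M + 1) ^ 2 := by linear_combination hAB + hqZ - hA
      exact ⟨sq_eq_sq_iff_eq_or_eq_neg.mp hA, sq_eq_sq_iff_eq_or_eq_neg.mp hB⟩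
    · right
      have e0 : A * M + B * (M + 1) = 0 := by
        rw [hc, mul_pow, h1] at e
        have : (A * M + B * (M + 1)) ^ 2 = 0 := by linarith
        exact pow_eq_zero_iff two_ne_zero |>.mp this
      have e1 : A * M = - (B * (M + 1)) := by linarith
      have hB : B ^ 2 = M ^ 2 := by
        apply sol
        have : (A * M) ^ 2 = (- (B * (M + 1))) ^ 2 := by rw [e1]
        have hA : A ^ 2 = Q - B ^ 2 := by linarith
        rw [neg_sq, mul_pow, mul_pow, hA] at this
        linear_combination - this + B ^ 2 * hqZ
      have hA : A ^ 2 = (M + 1) ^ 2 := by linear_combination hAB + hqZ - hB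
      exact ⟨sq_eq_sq_iff_eq_or_eq_neg.mp hA, sq_eq_sq_iff_eq_or_eq_neg.mp hB⟩
  have hprod : (A * (M + 1) - B * M) * (A * (M + 1) + B * M) = Q * (A ^ 2 - M ^ 2) := by
    linear_combination (-M ^ 2) * hAB - A ^ 2 * hqZ 
  have hdvd : Q ∣ (A * (M + 1) - B * M) * (A * (M + 1) + B * M) := ⟨_, hprod⟩
  by_cases h1 : (p : ℤ) ∣ A * (M + 1) - B * M
  · by_cases h2 : (p : ℤ) ∣ A * (M + 1) + B * M
    · exfalso
      apply hd
      constructor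
      · have : (p : ℤ) ∣ 2 * (A * (M + 1)) := by
          have := dvd_add h1 h2
          ring_nf at this ⊢; exact this
        rcases hpp.dvd_or_dvd this with h | h
        · exact absurd h hp2
        · exact (hpp.dvd_or_dvd h).resolve_right hpM1
      · have : (p : ℤ) ∣ 2 * (B * M) := by
          have := dvd_sub h2 h1
          ring_nf at this ⊢; exact this
        rcases hpp.dvd_or_dvd this with h | h
        · exact absurd h hp2
        · exact (hpp.dvd_or_dvd h).resolve_right hpM
    · have hcop : IsCoprime Q (A * (M + 1) + B * M) :=
        (hpp.coprime_iff_not_dvd.mpr h2).pow_left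
      have := key B hAB (hcop.dvd_of_dvd_mul_right hdvd)
      exact this
  · have hcop : IsCoprime Q (A * (M + 1) - B * M) :=
        (hpp.coprime_iff_not_dvd.mpr h1).pow_left
    have := key (-B) (by rw [neg_sq]; exact hAB) (by
      have := hcop.dvd_of_dvd_mul_left hdvd
      rwa [neg_mul, sub_neg_eq_add])
    rcases this with ⟨h, h'⟩ | ⟨h, h'⟩
    · left; refine ⟨h, ?_⟩; rcases h' with h' | h'
      · right; linarith
      · left; linarith
    · right; refine ⟨h, ?_⟩; rcases h' with h' | h'
      · right; linarith
      · left; linarith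

theorem aux_choose (p : ℕ) (hp : p.Prime) (b : ℕ) (hb : p = 4 * b + 1) (n : ℕ) :
    ∀ a, 4 * a + 1 = p ^ n → ¬ p ∣ Nat.choose (3 * a) (2 * a) := by
  have := Fact.mk hp
  induction n with
  | zero =>
    intro a ha
    have : a = 0 := by simpa using ha
    subst this
    simpa using hp.one_lt.ne'
  | succ n ih =>
    intro a ha
    have h4 : ∃ c, p ^ n = 4 * c + 1 := by
      have : p ^ n % 4 = 1 := by
        rw [Nat.pow_mod, hb]; simp [Nat.add_mod]
      exact ⟨p ^ n / 4, by omega⟩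
    obtain ⟨c, hc⟩ := h4
    have hac : a = p * c + b := by
      have : 4 * a + 1 = (4 * c + 1) * p := by rw [ha, pow_succ, hc]
      nlinarith
    have hp0 := hp.pos
    have e1 : 3 * a = 3 * b + p * (3 * c) := by rw [hac]; ring
    have e2 : 2 * a = 2 * b + p * (2 * c) := by rw [hac]; ring
    have m1 : 3 * a % p = 3 * b := by
      rw [e1, Nat.add_mul_mod_self_left, Nat.mod_eq_of_lt (by omega)]
    have m2 : 2 * a % p = 2 * b := by
      rw [e2, Nat.add_mul_mod_self_left, Nat.mod_eq_of_lt (by omega)]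
    have d1 : 3 * a / p = 3 * c := by
      rw [e1, Nat.add_mul_div_left _ _ hp0, Nat.div_eq_of_lt (by omega)]; omega
    have d2 : 2 * a / p = 2 * c := by
      rw [e2, Nat.add_mul_div_left _ _ hp0, Nat.div_eq_of_lt (by omega)]; omega
    have := Choose.choose_modEq_choose_mod_mul_choose_div_nat (p := p) (n := 3 * a) (k := 2 * a)
    rw [m1, m2, d1, d2] at this
    intro hdv
    have h0 := (Nat.modEq_zero_iff_dvd.mp (this.symm.trans (Nat.modEq_zero_iff_dvd.mpr hdv)))
    rcases (hp.dvd_mul.mp h0) with h | h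
    · have hf := Nat.choose_mul_factorial_mul_factorial (n := 3 * b) (k := 2 * b) (by omega)
      have h5 : p ∣ (3 * b).factorial := by
        rw [← hf, mul_assoc]
        exact h.mul_right _
      have := (hp.dvd_factorial).mp h5
      omega
    · exact ih c hc.symm h

theorem aux_mod4 (p m n : ℕ) (hp : p.Prime) (hn : n ≠ 0)
    (hq : p ^ n = 2 * m ^ 2 + 2 * m + 1) : ∃ b, p = 4 * b + 1 := by
  have := Fact.mk hp
  have h0 : ((m : ZMod p)) ^ 2 + ((m : ZMod p) + 1) ^ 2 = 0 := by
    have : ((p ^ n : ℕ) : ZMod p) = ((2 * m ^ 2 + 2 * m + 1 : ℕ) : ZMod p) := by rw [hq]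
    push_cast at this
    rw [CharP.cast_eq_zero, zero_pow hn] at this
    linear_combination -this
  have hm : (m : ZMod p) ≠ 0 := by
    intro h; rw [h] at h0; simp at h0
  have h3 := ZMod.mod_four_ne_three_of_sq_eq_neg_sq' (p := p) (x := (m : ZMod p) + 1) hm
    (by linear_combination h0)
  have hodd : Odd p := by
    rcases hp.eq_two_or_odd' with h | h
    · exfalso
      subst h
      have : 2 ∣ 2 ^ n := dvd_pow_self _ hn
      omega
    · exact h
  rw [Nat.odd_iff] at hodd
  exact ⟨p / 4, by omega⟩

/-- sum of even powers, reduction mod p -/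
theorem aux_sum (p a : ℕ) (F F2 : Type) [Field F] [Fintype F] [Field F2] [Algebra F F2]
    [CharP F2 p] (hF : Fintype.card F = 4 * a + 1) (ha : 0 < a)
    (hch : ¬ p ∣ Nat.choose (3 * a) (2 * a)) (u d : F2) (hu : u ≠ 0) (hd : d ≠ 0) :
    ∑ t : F, (u - (algebraMap F F2 t) ^ 2 * d) ^ (3 * a) ≠ 0 := by
  classical
  have hpow : ∀ j : ℕ, j ≤ 3 * a → (∑ t : F, t ^ (2 * j) : F) = if j = 2 * a then -1 else 0 := by
    intro j hj
    by_cases hj0 : j = 0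
    · subst hj0
      rw [if_neg (by omega)]
      simp
    have h1 := FiniteField.sum_pow_units F (2 * j)
    have h2 : (∑ x : Fˣ, (x ^ (2 * j) : F)) = ∑ t : F, t ^ (2 * j) := by
      rw [Fintype.sum_eq_add_sum_compl (0 : F), zero_pow (by omega), zero_add]
      refine Finset.sum_bij (fun x _ => (x : F)) ?_ ?_ ?_ ?_
      · intro x _; simp
      · intro x _ y _ h; exact Units.ext h
      · intro y hy
        exact ⟨Units.mk0 y (by simpa using hy), Finset.mem_univ _, rfl⟩
      · intro x _; rfl
    rw [← h2, h1, hF]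
    have : (4 * a + 1 - 1 ∣ 2 * j) ↔ j = 2 * a := by
      constructor
      · rintro ⟨c, hc⟩
        have hc' : 2 * j = 4 * a * c := by simpa using hc
        have hc2 : c < 2 := by
          by_contra h
          have : 4 * a * 2 ≤ 4 * a * c := Nat.mul_le_mul_left _ (by omega)
          omega
        interval_cases c <;> omega
      · rintro rfl
        exact ⟨1, by simp; ring⟩
    simp only [this]
  have hexp : ∑ t : F, (u - (algebraMap F F2 t) ^ 2 * d) ^ (3 * a)
      = ∑ j ∈ Finset.range (3 * a + 1), ((-d) ^ j * u ^ (3 * a - j) * (Nat.choose (3 * a) j : F2)) *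
        algebraMap F F2 (∑ t : F, t ^ (2 * j)) := by
    simp only [map_sum, Finset.mul_sum]
    rw [Finset.sum_comm]
    refine Finset.sum_congr rfl fun t _ => ?_
    rw [sub_eq_neg_add, add_pow]
    refine Finset.sum_congr rfl fun j _ => ?_
    rw [map_pow, pow_mul, ← mul_neg, mul_pow]
    ring
  rw [hexp, Finset.sum_eq_single (2 * a)]
  · rw [hpow _ (by omega), if_pos rfl]
    have : ((Nat.choose (3 * a) (2 * a) : ℕ) : F2) ≠ 0 := by
      rw [Ne, CharP.cast_eq_zero_iff F2 p]; exact hch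
    simp [hd, hu, this]
  · intro j hj hne
    rw [hpow j (by simp at hj; omega), if_neg hne]; simp
  · intro h; simp at h; omega

theorem aux_char (q a : ℕ) (F F2 : Type) [Field F] [Fintype F] [Field F2] [Fintype F2] [Algebra F F2]
    (hF : Fintype.card F = q) (hF2 : Fintype.card F2 = q ^ 2) (hqa : q = 4 * a + 1) (ha : 0 < a)
    (hchar : ringChar F2 ≠ 2)
    (χ : MulChar F2 ℂ) (hχ4 : orderOf χ = 4) :
    ∃ (s0 : F2) (i0 : {r : ℂ // r * r = ((-1 : ℤ) : ℂ)}) (j0 : {r : F2 // r * r = ((-1 : ℤ) : F2)}),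
      s0 ≠ 0 ∧ s0 ^ q = - s0 ∧
      (∀ y : F2, y ≠ 0 → ∃ x : GaussianInt, Zsqrtd.lift i0 x = χ y ∧
        Zsqrtd.lift j0 x = (y ^ (q + 1)) ^ (3 * a)) ∧
      (∀ y : F2, y ≠ 0 → χ y ^ 4 = 1) ∧
      (∀ c : F, χ (algebraMap F F2 c) = quadChar F c) := by
  classical
  obtain ⟨g, hg⟩ := IsCyclic.exists_generator (α := F2ˣ)
  have hgord : orderOf g = q ^ 2 - 1 := by
    rw [orderOf_eq_card_of_forall_mem_zpowers hg, Nat.card_eq_fintype_card, Fintype.card_units, hF2]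
  have hN : q ^ 2 - 1 = 4 * (a * (q + 1)) := by
    have : q ^ 2 = 4 * (a * (q + 1)) + 1 := by rw [hqa]; ring
    omega
  have hpos : 0 < a * (q + 1) := by positivity
  have hgen : ∀ y : F2, y ≠ 0 → ∃ k : ℕ, y = (g : F2) ^ k := by
    intro y hy
    have := hg (Units.mk0 y hy)
    rw [← mem_powers_iff_mem_zpowers] at this
    obtain ⟨k, hk⟩ := this
    refine ⟨k, ?_⟩
    have := congrArg (Units.val) hk
    simpa using this.symm
  have hg1 : (g : F2) ^ (q ^ 2 - 1) = 1 := by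
    rw [← hgord, ← Units.val_pow_eq_pow_val, pow_orderOf_eq_one, Units.val_one]
  have hghalf : (g : F2) ^ (2 * (a * (q + 1))) = -1 := by
    have h1 : ((g : F2) ^ (2 * (a * (q + 1)))) ^ 2 = 1 := by
      rw [← pow_mul, ← hg1, hN]; congr 1; ring
    rcases sq_eq_one_iff.mp h1 with h | h
    · exfalso
      have h2 : g ^ (2 * (a * (q + 1))) = 1 := by
        apply Units.ext; simpa using h
      have := orderOf_dvd_of_pow_eq_one h2
      rw [hgord, hN] at this
      have := Nat.le_of_dvd (by omega) this
      omega
    · exact h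
  have hneg : (-1 : F2) ≠ 1 := Ring.neg_one_ne_one_of_char_ne_two hchar
  have hcharF : ringChar F ≠ 2 := by
    rw [← Algebra.ringChar_eq F F2] at hchar
    exact hchar
  have hχp : χ ^ 4 = 1 := by rw [← hχ4]; exact pow_orderOf_eq_one χ
  have hχ4' : ∀ y : F2, y ≠ 0 → χ y ^ 4 = 1 := by
    intro y hy
    have := congrArg (fun f : MulChar F2 ℂ => f y) hχp
    simp only [MulChar.pow_apply' χ (by norm_num : (4:ℕ) ≠ 0)] at this
    rw [this, MulChar.one_apply (isUnit_iff_ne_zero.mpr hy)]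
  have hχg : χ (g : F2) ^ 2 = -1 := by
    have h4 := hχ4' g g.ne_zero
    have : (χ (g : F2) ^ 2) ^ 2 = 1 := by rw [← pow_mul]; exact h4
    rcases sq_eq_one_iff.mp this with h | h
    · exfalso
      have h2 : χ ^ 2 = 1 := by
        apply MulChar.ext
        intro u
        obtain ⟨k, hk⟩ := hgen u u.ne_zero
        rw [MulChar.pow_apply' χ (by norm_num), MulChar.one_apply u.isUnit, hk, map_pow, ← pow_mul,
          mul_comm, pow_mul, h, one_pow]
      have := orderOf_dvd_of_pow_eq_one h2
      rw [hχ4] at this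
      omega
    · exact h
  have hj0 : ((g : F2) ^ ((q + 1) * (3 * a))) * ((g : F2) ^ ((q + 1) * (3 * a))) = -1 := by
    rw [← pow_add, show (q + 1) * (3 * a) + (q + 1) * (3 * a) = 2 * (a * (q + 1)) * 3 by ring,
      pow_mul, hghalf]; ring
  refine ⟨(g : F2) ^ (2 * a + 1), ⟨χ g, by rw [← sq, hχg]; simp⟩,
    ⟨(g : F2) ^ ((q + 1) * (3 * a)), by rw [hj0]; simp⟩, pow_ne_zero _ g.ne_zero, ?_, ?_, hχ4', ?_⟩
  · rw [← pow_mul, show (2 * a + 1) * q = (2 * a + 1) + 2 * (a * (q + 1)) by rw [hqa]; ring,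
      pow_add, hghalf]; ring
  · intro y hy
    obtain ⟨k, rfl⟩ := hgen y hy
    refine ⟨(⟨0, 1⟩ : GaussianInt) ^ k, ?_, ?_⟩
    · rw [map_pow, map_pow]; congr 1; simp
    · rw [map_pow]
      simp only [Zsqrtd.lift_apply_apply]
      simp only [Int.cast_zero, Int.cast_one, zero_add, one_mul]
      simp only [← pow_mul]
      congr 1; ring
  · intro c
    unfold quadChar
    by_cases hc : c = 0
    · rw [hc, map_zero, if_pos rfl]; exact χ.map_zero
    rw [if_neg hc]
    obtain ⟨k, hk⟩ := hgen (algebraMap F F2 c) (by simpa using hc)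
    have h1 : (g : F2) ^ (k * (4 * a)) = 1 := by
      rw [pow_mul, ← hk, ← map_pow]
      have := FiniteField.pow_card_sub_one_eq_one c hc
      rw [hF, hqa] at this
      simp only [Nat.add_sub_cancel] at this
      rw [this, map_one]
    have h2 : g ^ (k * (4 * a)) = 1 := by
      apply Units.ext; simpa using h1
    have h3 := orderOf_dvd_of_pow_eq_one h2
    rw [hgord, hN, show 4 * (a * (q + 1)) = (q + 1) * (4 * a) by ring] at h3
    have h4 : q + 1 ∣ k := Nat.dvd_of_mul_dvd_mul_right (by omega) h3
    obtain ⟨j, rfl⟩ := h4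
    have e1 : χ (algebraMap F F2 c) = (-1) ^ j := by
      rw [hk, map_pow, show (q + 1) * j = 2 * ((2 * a + 1) * j) by rw [hqa]; ring, pow_mul, hχg,
        pow_mul]
      congr 1
      exact Odd.neg_one_pow ⟨a, rfl⟩
    have e2 : algebraMap F F2 (c ^ (2 * a)) = (-1) ^ j := by
      rw [map_pow, hk, ← hghalf, ← pow_mul, ← pow_mul]; congr 1; ring
    rw [e1]
    have h5 := FiniteField.isSquare_iff hcharF hc
    rw [hF, hqa, show (4 * a + 1) / 2 = 2 * a by omega] at h5
    rcases Nat.even_or_odd j with hj | hj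
    · rw [hj.neg_one_pow] at e2 ⊢
      rw [if_pos]
      rw [h5]
      exact (algebraMap F F2).injective (by rw [e2, map_one])
    · rw [hj.neg_one_pow] at e2 ⊢
      rw [if_neg]
      rw [h5]
      intro h
      rw [h, map_one] at e2
      exact hneg e2.symm

theorem aux_parity (F : Type) [Field F] [Fintype F] (h2 : (2 : F) ≠ 0) (f : F → ℤ)
    (hf : ∀ t, f (-t) = f t) : ((∑ t, f t : ℤ) : ZMod 2) = (f 0 : ZMod 2) := by
  classical
  rw [Fintype.sum_eq_add_sum_compl (0 : F)]
  push_cast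
  have : ∑ t ∈ ({0}ᶜ : Finset F), ((f t : ℤ) : ZMod 2) = 0 := by
    refine Finset.sum_involution (fun t _ => -t) ?_ ?_ ?_ ?_
    · intro t _
      rw [hf t]
      exact CharTwo.add_self_eq_zero _
    · intro t ht _ h
      simp only [Finset.mem_compl, Finset.mem_singleton] at ht
      apply ht
      have : 2 * t = 0 := by linear_combination -h
      exact (mul_eq_zero.mp this).resolve_left h2
    · intro t ht; simpa using ht
    · intro t _; simp
  rw [this, add_zero]

theorem aux_main (q a p : ℕ) (F F2 : Type) [Field F] [Fintype F] [Field F2] [Fintype F2]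
    [Algebra F F2] [CharP F2 p]
    (hF : Fintype.card F = q) (hF2 : Fintype.card F2 = q ^ 2) (hqa : q = 4 * a + 1) (ha : 0 < a)
    (hp2 : p ≠ 2)
    (hch : ¬ p ∣ Nat.choose (3 * a) (2 * a))
    (ψ : AddChar F ℂ) (hψ : ∃ a, ψ a ≠ 1)
    (tr : F2 → F) (htr : ∀ x : F2, algebraMap F F2 (tr x) = x + x ^ q)
    (χ : MulChar F2 ℂ) (hχ4 : orderOf χ = 4) :
    ∃ A B e : ℤ, (e = 1 ∨ e = -1) ∧ Odd A ∧ A ^ 2 + B ^ 2 = q ∧ ¬ ((p : ℤ) ∣ A ∧ (p : ℤ) ∣ B) ∧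
      (∑ x : F, quadChar F x * ψ x) * (∑ y : F2, χ y * ψ (tr y)) / q = A + B * (e * I) := by
  classical
  have hchar : ringChar F2 ≠ 2 := by rwa [ringChar.eq F2 p]
  obtain ⟨s0, i0, j0, hs0, hs0q, hX, hχ4', hη⟩ := aux_char q a F F2 hF hF2 hqa ha hchar χ hχ4
  have hcharF : ringChar F ≠ 2 := by
    rw [← Algebra.ringChar_eq F F2] at hchar
    exact hchar
  have h2F : (2 : F) ≠ 0 := Ring.two_ne_zero hcharF
  have h2F2 : (2 : F2) ≠ 0 := Ring.two_ne_zero hchar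
  have hinj := (algebraMap F F2).injective
  have hadd : ∀ x y : F2, (x + y) ^ q = x ^ q + y ^ q := by
    intro x y
    have := map_add (FiniteField.frobeniusAlgHom F F2) x y
    simpa [FiniteField.coe_frobeniusAlgHom, hF] using this
  have hfr : ∀ c : F, (algebraMap F F2 c) ^ q = algebraMap F F2 c := by
    intro c
    rw [← map_pow, ← hF, FiniteField.pow_card]
  -- parametrisation
  let Y : F → F → F2 := fun c t => algebraMap F F2 (c / 2) + algebraMap F F2 t * s0
  have hYq : ∀ c t, Y c t ^ q = Y c (-t) := by
    intro c t
    simp only [Y]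
    rw [hadd, mul_pow, hfr, hfr, hs0q, map_neg]; ring
  have htrY : ∀ c t, tr (Y c t) = c := by
    intro c t
    apply hinj
    rw [htr, hYq]
    simp only [Y]
    rw [map_neg, map_div₀, map_ofNat]
    field_simp
    ring
  have hbij : Function.Bijective (fun z : F × F => Y z.1 z.2) := by
    rw [Fintype.bijective_iff_injective_and_card]
    constructor
    · rintro ⟨c, t⟩ ⟨c', t'⟩ h
      simp only at h
      have hc : c = c' := by rw [← htrY c t, h, htrY]
      subst hc
      simp only [Y] at h
      have := hinj (mul_right_cancel₀ hs0 (add_left_cancel h))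
      rw [this]
    · rw [Fintype.card_prod, hF, hF2, sq]
  have hY0 : ∀ t, Y 1 t ≠ 0 := by
    intro t h
    have h1 := htrY 1 t
    have h0 : tr 0 = 0 := by
      apply hinj; rw [htr, map_zero, zero_pow (by omega), add_zero]
    rw [h, h0] at h1
    exact zero_ne_one h1
  -- Gaussian integer
  choose! X hX1 hX2 using hX
  set S : GaussianInt := ∑ t : F, X (Y 1 t) with hS
  have hS1 : Zsqrtd.lift i0 S = ∑ t : F, χ (Y 1 t) := by
    rw [hS, map_sum]
    exact Finset.sum_congr rfl fun t _ => hX1 _ (hY0 t)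
  have hS2 : Zsqrtd.lift j0 S ≠ 0 := by
    have := aux_sum p a F F2 (by rw [hF, hqa]) ha hch (algebraMap F F2 (1 / 2) ^ 2) (s0 ^ 2)
      (by simp [h2F]) (pow_ne_zero _ hs0)
    convert this using 1
    rw [hS, map_sum]
    refine Finset.sum_congr rfl fun t _ => ?_
    rw [hX2 _ (hY0 t), pow_succ, hYq]
    congr 1
    simp only [Y, map_neg]
    ring
  have hi0 : (i0 : ℂ) = I ∨ (i0 : ℂ) = -I := by
    have : (i0 : ℂ) ^ 2 = I ^ 2 := by rw [sq, i0.2, I_sq]; simp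
    exact sq_eq_sq_iff_eq_or_eq_neg.mp this
  have hlinj : Function.Injective (Zsqrtd.lift i0) :=
    Zsqrtd.lift_injective i0 (by intro n hn; nlinarith [mul_self_nonneg n])
  -- evenness
  have hXe : ∀ t, X (Y 1 (-t)) = X (Y 1 t) := by
    intro t
    apply hlinj
    rw [hX1 _ (hY0 _), hX1 _ (hY0 _), ← hYq, map_pow, hqa, pow_succ, pow_mul, hχ4' _ (hY0 t),
      one_pow, one_mul]
  have hXh : X (Y 1 0) = 1 ∨ X (Y 1 0) = -1 := by
    have h1 : χ (Y 1 0) = quadChar F (1 / 2) := by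
      rw [← hη]; simp only [Y]; simp
    have h2 : quadChar F (1 / 2) = 1 ∨ quadChar F (1 / 2) = -1 := by
      unfold quadChar
      rw [if_neg (by simp [h2F])]
      split_ifs <;> simp
    rcases h2 with h | h
    · left; apply hlinj; rw [hX1 _ (hY0 _), h1, h, map_one]
    · right; apply hlinj; rw [hX1 _ (hY0 _), h1, h, map_neg, map_one]
  have hre : S.re = ∑ t : F, (X (Y 1 t)).re := by
    rw [hS]
    exact map_sum (⟨⟨Zsqrtd.re, rfl⟩, fun _ _ => rfl⟩ : GaussianInt →+ ℤ) _ _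
  have hodd : Odd S.re := by
    have h := aux_parity F h2F (fun t => (X (Y 1 t)).re) (fun t => by simp only [hXe])
    rw [← hre] at h
    have h1 : (((X (Y 1 0)).re : ℤ) : ZMod 2) = 1 := by
      rcases hXh with h | h <;> rw [h] <;> simp
    rw [h1] at h
    exact (ZMod.intCast_eq_one_iff_odd).mp h
  -- Gauss sums
  set η : MulChar F ℂ := (quadraticChar F).ringHomComp (Int.castRingHom ℂ) with hηdef
  have hηq : ∀ x, η x = quadChar F x := by
    intro x
    simp only [hηdef, MulChar.ringHomComp_apply, quadChar]
    by_cases hx : x = 0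
    · simp [hx]
    · rw [if_neg hx]
      split_ifs with hs
      · rw [(quadraticChar_one_iff_isSquare hx).mpr hs]; simp
      · rw [quadraticChar_neg_one_iff_not_isSquare.mpr hs]; simp
  have hη1 : η ≠ 1 := by
    rw [hηdef, MulChar.ringHomComp_ne_one_iff (RingHom.injective_int _)]
    exact quadraticChar_ne_one hcharF
  have hψ1 : ψ ≠ 1 := by
    rintro rfl
    obtain ⟨b, hb⟩ := hψ
    simp at hb
  set G : ℂ := ∑ x : F, quadChar F x * ψ x with hG
  set G2 : ℂ := ∑ y : F2, χ y * ψ (tr y) with hG2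
  have hGsq : G ^ 2 = q := by
    have h := gaussSum_sq hη1 ((quadraticChar_isQuadratic F).comp _) (AddChar.IsPrimitive.of_ne_one hψ1)
    have hm1 : η (-1) = 1 := by
      rw [hηq]
      unfold quadChar
      rw [if_neg (by simp), if_pos]
      rw [FiniteField.isSquare_neg_one_iff, hF]
      omega
    rw [hm1, hF, one_mul] at h
    rw [← h]
    simp only [gaussSum, hηq, hG]
  have hG20 : G2 = G * ∑ t : F, χ (Y 1 t) := by
    have h1 : G2 = ∑ c : F, ∑ t : F, χ (Y c t) * ψ c := by
      rw [hG2, ← Function.Bijective.sum_comp hbij, Fintype.sum_prod_type]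
      simp only [htrY]
    rw [h1, hG, Finset.sum_mul]
    refine Finset.sum_congr rfl fun c _ => ?_
    rw [← Finset.sum_mul]
    by_cases hc : c = 0
    · subst hc
      have : ∑ t : F, χ (Y 0 t) = 0 := by
        simp only [Y, zero_div, map_zero, zero_add, map_mul, hη, ← hηq]
        rw [← Finset.sum_mul, MulChar.sum_eq_zero_of_ne_one hη1, zero_mul]
      rw [this]
      simp [quadChar]
    · have : ∑ t : F, χ (Y c t) = quadChar F c * ∑ t : F, χ (Y 1 t) := by
        rw [← Equiv.sum_comp (Equiv.mulLeft₀ c hc), Finset.mul_sum]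
        refine Finset.sum_congr rfl fun t _ => ?_
        rw [← hη, ← map_mul]
        congr 1
        change Y c (c * t) = _
        simp only [Y, map_mul, map_div₀, map_one]
        ring
      rw [this]; ring
  have hq0 : (q : ℂ) ≠ 0 := by
    have : q ≠ 0 := by omega
    exact_mod_cast this
  have hval : G * G2 / q = ∑ t : F, χ (Y 1 t) := by
    rw [hG20, ← mul_assoc, ← sq, hGsq, mul_div_assoc, mul_div_cancel₀ _ hq0]
  -- norm
  have hnorm2 : normSq G2 = (q : ℝ) ^ 2 := by
    have htradd : ∀ x y, tr (x + y) = tr x + tr y := by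
      intro x y
      apply hinj
      rw [map_add, htr, htr, htr, hadd]; ring
    let T : F2 →+ F := AddMonoidHom.mk' tr htradd
    let ψ' : AddChar F2 ℂ := ψ.compAddMonoidHom T
    have hψ'1 : ψ' ≠ 1 := by
      intro h
      obtain ⟨b, hb⟩ := hψ
      apply hb
      have := DFunLike.congr_fun h (Y b 0)
      simp only [ψ', AddChar.compAddMonoidHom_apply, AddChar.one_apply] at this
      rw [show T (Y b 0) = b from htrY b 0] at this
      exact this
    have hχ1 : χ ≠ 1 := by
      rintro rfl
      simp at hχ4
    have h := gaussSum_mul_gaussSum_eq_card hχ1 (AddChar.IsPrimitive.of_ne_one hψ'1)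
    rw [← star_gaussSum_eq, hF2] at h
    have hg : gaussSum χ ψ' = G2 := rfl
    rw [hg] at h
    have h' : ((normSq G2 : ℝ) : ℂ) = ((q : ℝ) ^ 2 : ℝ) := by
      rw [← mul_conj]; push_cast at h ⊢; exact h
    exact_mod_cast h'
  have hnorm1 : normSq G = (q : ℝ) := by
    have h := congrArg normSq hGsq
    rw [map_pow, normSq_natCast, ← sq] at h
    exact (pow_left_inj₀ (normSq_nonneg _) (by positivity) two_ne_zero).mp h
  have hnS : normSq (∑ t : F, χ (Y 1 t)) = (q : ℝ) := by
    have h := congrArg normSq hG20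
    rw [map_mul, hnorm1, hnorm2] at h
    have : (q : ℝ) ≠ 0 := by exact_mod_cast hq0
    have h' : (q : ℝ) * q = q * normSq (∑ t : F, χ (Y 1 t)) := by rw [← h]; ring
    exact (mul_left_cancel₀ this h').symm
  have hfin : ∃ e : ℤ, (e = 1 ∨ e = -1) ∧ (i0 : ℂ) = e * I := by
    rcases hi0 with h | h
    · exact ⟨1, Or.inl rfl, by rw [h]; simp⟩
    · exact ⟨-1, Or.inr rfl, by rw [h]; simp⟩
  obtain ⟨e, he, hie⟩ := hfin
  have hSv : ∑ t : F, χ (Y 1 t) = S.re + S.im * (e * I) := by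
    rw [← hS1, Zsqrtd.lift_apply_apply, hie]
  refine ⟨S.re, S.im, e, he, hodd, ?_, ?_, ?_⟩
  · rw [hSv] at hnS
    have h : ((S.re : ℝ)) ^ 2 + (S.im : ℝ) ^ 2 = q := by
      rw [← hnS]
      rcases he with rfl | rfl <;> simp [normSq_apply] <;> ring
    exact_mod_cast h
  · rintro ⟨h1, h2⟩
    apply hS2
    rw [Zsqrtd.lift_apply_apply, (CharP.intCast_eq_zero_iff F2 p _).mpr h1,
      (CharP.intCast_eq_zero_iff F2 p _).mpr h2]
    simp
  · rw [hval, hSv]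

theorem stmt_12 (m q : ℕ) (hm : 0 < m) (hq : q = 2 * m ^ 2 + 2 * m + 1)
    (hqpp : IsPrimePow q)
    (F F2 : Type) [Field F] [Fintype F] [Field F2] [Fintype F2] [Algebra F F2]
    (hF : Fintype.card F = q) (hF2 : Fintype.card F2 = q ^ 2)
    (ψ : AddChar F ℂ) (hψ : ∃ a, ψ a ≠ 1)
    (tr : F2 → F) (htr : ∀ x : F2, algebraMap F F2 (tr x) = x + x ^ q)
    (χ : MulChar F2 ℂ) (hχ4 : orderOf χ = 4) :
    ∃ ε δ : ℤ, (ε = 1 ∨ ε = -1) ∧ (δ = 1 ∨ δ = -1) ∧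
      (Odd m →
        (∑ x : F, quadChar F x * ψ x) * (∑ y : F2, χ y * ψ (tr y)) / q =
          (ε : ℂ) * m + (δ : ℂ) * (m + 1) * Complex.I) ∧
      (Even m →
        (∑ x : F, quadChar F x * ψ x) * (∑ y : F2, χ y * ψ (tr y)) / q =
          (ε : ℂ) * (m + 1) + (δ : ℂ) * m * Complex.I) := by
  obtain ⟨p, _, n, hp, hcard⟩ := FiniteField.card' F
  have hpn : p ^ (n : ℕ) = 2 * m ^ 2 + 2 * m + 1 := by rw [← hcard, hF, hq]
  obtain ⟨b, hb⟩ := aux_mod4 p m n hp n.ne_zero hpn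
  have h4 : ∃ a, q = 4 * a + 1 := by
    obtain ⟨c, hc⟩ := Nat.even_mul_succ_self m
    exact ⟨c, by rw [hq]; nlinarith⟩
  obtain ⟨a, ha⟩ := h4
  have ha0 : 0 < a := by
    rcases Nat.eq_zero_or_pos a with h | h
    · subst h; nlinarith
    · exact h
  have : CharP F2 p := charP_of_injective_algebraMap (algebraMap F F2).injective p
  have hch := aux_choose p hp b hb n a (by rw [← ha, hpn, hq])
  obtain ⟨A, B, e, he, hodd, hAB, hnd, hval⟩ := aux_main q a p F F2 hF hF2 ha ha0 (by omega) hch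
    ψ hψ tr htr χ hχ4
  rw [hval]
  have harith := aux_arith A B m p n hp n.ne_zero hpn
    (by rw [hAB, ← hF, hcard]; push_cast; rfl) hnd
  have key : ∀ (u v : ℤ), (A = u ∨ A = -u) → (B = v ∨ B = -v) →
      ∃ ε δ : ℤ, (ε = 1 ∨ ε = -1) ∧ (δ = 1 ∨ δ = -1) ∧
       (A : ℂ) + B * (e * I) = (ε : ℂ) * u + (δ : ℂ) * v * I := by
    intro u v hu hv
    have h1 : ∃ ε : ℤ, (ε = 1 ∨ ε = -1) ∧ A = ε * u := by
      rcases hu with h | h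
      · exact ⟨1, by simp, by simp [h]⟩
      · exact ⟨-1, by simp, by simp [h]⟩
    have h2 : ∃ ε : ℤ, (ε = 1 ∨ ε = -1) ∧ B = ε * v := by
      rcases hv with h | h
      · exact ⟨1, by simp, by simp [h]⟩
      · exact ⟨-1, by simp, by simp [h]⟩
    obtain ⟨ε, hε, rfl⟩ := h1
    obtain ⟨δ, hδ, rfl⟩ := h2
    refine ⟨ε, δ * e, hε, ?_, ?_⟩
    · rcases hδ with rfl | rfl <;> rcases he with rfl | rfl <;> simp
    · push_cast; ring
  rcases Nat.even_or_odd m with hme | hmo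
  · have hnotodd : ¬ Odd m := Nat.not_odd_iff_even.mpr hme
    rcases harith with ⟨h1, _⟩ | ⟨h1, h2⟩
    · exfalso
      obtain ⟨k, hk⟩ := hme
      obtain ⟨l, hl⟩ := hodd
      omega
    · obtain ⟨ε, δ, h3, h4, h5⟩ := key _ _ h1 h2
      refine ⟨ε, δ, h3, h4, fun h => absurd h hnotodd, fun _ => ?_⟩
      rw [h5]; push_cast; rfl
  · have hnoteven : ¬ Even m := Nat.not_even_iff_odd.mpr hmo
    rcases harith with ⟨h1, h2⟩ | ⟨h1, _⟩
    · obtain ⟨ε, δ, h3, h4, h5⟩ := key _ _ h1 h2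
      refine ⟨ε, δ, h3, h4, fun _ => ?_, fun h => absurd h hnoteven⟩
      rw [h5]; push_cast; rfl
    · exfalso
      obtain ⟨k, hk⟩ := hmo
      obtain ⟨l, hl⟩ := hodd
      omega
end
end
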